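/- arXiv:1911.10032 — 4 statements merged into one kernel-verified Lean document; each statement's English description precedes it below -/
import Mathlib

section
/- Let 0 < s < d and let E ⊆ ℝ^d be a Borel set that is mid-point convex but not essentially convex. Then the s-dimensional Hausdorff measure of E is either 0 or ∞. -/
open MeasureTheory Set Metric Filter
open scoped ENNReal

/-- A set `E ⊆ ℝ^d` is mid-point convex if the midpoint of any two of its points
belongs to it. -/
def MidpointConvexSet {d : ℕ} (E : Set (EuclideanSpace ℝ (Fin d))) : Prop :=
  ∀ x ∈ E, ∀ y ∈ E, midpoint ℝ x y ∈ E

/-- A set `E ⊆ ℝ^d` is essentially convex if there are an integer `1 ≤ s ≤ d` and an affine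
subspace `L` of dimension `s` containing `E` such that, in the subspace topology of `L`,
`E` has nonempty interior and `convexHull E \ E` lies in the frontier of `convexHull E`. -/
def EssentiallyConvex {d : ℕ} (E : Set (EuclideanSpace ℝ (Fin d))) : Prop :=
  ∃ s : ℕ, 1 ≤ s ∧ s ≤ d ∧
    ∃ L : AffineSubspace ℝ (EuclideanSpace ℝ (Fin d)),
      Module.finrank ℝ L.direction = s ∧
      E ⊆ (L : Set (EuclideanSpace ℝ (Fin d))) ∧
      (interior ((Subtype.val : L → EuclideanSpace ℝ (Fin d)) ⁻¹' E)).Nonempty ∧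
      (Subtype.val : L → EuclideanSpace ℝ (Fin d)) ⁻¹' (convexHull ℝ E \ E) ⊆
        frontier ((Subtype.val : L → EuclideanSpace ℝ (Fin d)) ⁻¹' (convexHull ℝ E))

open scoped Topology Pointwise

section MidpointConvex

variable {V : Type*} [NormedAddCommGroup V] [NormedSpace ℝ V] {F : Set V}

/-- A midpoint convex set is stable under convex combinations with weight `2⁻ᵏ`. -/
lemma lineMap_inv_two_pow_mem (hF : ∀ x ∈ F, ∀ y ∈ F, midpoint ℝ x y ∈ F) {x y : V}
    (hx : x ∈ F) (hy : y ∈ F) (k : ℕ) : AffineMap.lineMap x y ((2 : ℝ)⁻¹ ^ k) ∈ F := by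
  induction k with
  | zero => simpa using hy
  | succ k ih =>
    convert hF _ hx _ ih using 1
    simp only [midpoint_eq_smul_add, AffineMap.lineMap_apply_module, invOf_eq_inv, pow_succ]
    module

/-- A midpoint convex set is stable under dyadic convex combinations. -/
lemma lineMap_div_two_pow_mem (hF : ∀ x ∈ F, ∀ y ∈ F, midpoint ℝ x y ∈ F) {x y : V}
    (hx : x ∈ F) (hy : y ∈ F) (n : ℕ) :
    ∀ k : ℕ, k ≤ 2 ^ n → AffineMap.lineMap x y ((k : ℝ) / 2 ^ n) ∈ F := by
  induction n with
  | zero =>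
    intro k hk
    interval_cases k
    · simpa using hx
    · simpa using hy
  | succ n ih =>
    intro k hk
    rw [pow_succ] at hk
    convert hF _ (ih (k / 2) (by omega)) _ (ih (k - k / 2) (by omega)) using 1
    have h : (k : ℝ) = (k / 2 : ℕ) + (k - k / 2 : ℕ) := by
      rw [← Nat.cast_add]
      congr 1
      omega
    rw [h]
    simp only [midpoint_eq_smul_add, AffineMap.lineMap_apply_module, invOf_eq_inv, pow_succ]
    module

lemma IsClosed.convex_of_midpoint_mem (hc : IsClosed F)
    (hF : ∀ x ∈ F, ∀ y ∈ F, midpoint ℝ x y ∈ F) : Convex ℝ F := by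
  rw [convex_iff_segment_subset]
  intro x hx y hy
  rw [segment_eq_image_lineMap]
  rintro _ ⟨t, ht, rfl⟩
  have hpow : Tendsto (fun n : ℕ => (2 : ℝ) ^ n) atTop atTop :=
    tendsto_pow_atTop_atTop_of_one_lt one_lt_two
  have hlim : Tendsto (fun n : ℕ => (⌊t * 2 ^ n⌋₊ : ℝ) / 2 ^ n) atTop (𝓝 t) :=
    (tendsto_nat_floor_mul_div_atTop ht.1).comp hpow
  have hcont : Continuous (AffineMap.lineMap x y : ℝ → V) := AffineMap.lineMap_continuous
  refine hc.mem_of_tendsto ((hcont.tendsto t).comp hlim) (Eventually.of_forall fun n => ?_)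
  refine lineMap_div_two_pow_mem hF hx hy n _ (Nat.floor_le_of_le ?_)
  push_cast
  exact mul_le_of_le_one_left (by positivity) ht.2

lemma convex_closure_of_midpoint_mem (hF : ∀ x ∈ F, ∀ y ∈ F, midpoint ℝ x y ∈ F) :
    Convex ℝ (closure F) := by
  refine isClosed_closure.convex_of_midpoint_mem fun x hx y hy => ?_
  refine map_mem_closure₂ (f := midpoint ℝ) ?_ hx hy hF
  simp only [Function.uncurry_def, midpoint_eq_smul_add]
  fun_prop

/-- A midpoint convex set with nonempty interior contains the interior of its convex hull. -/
lemma interior_convexHull_subset_of_midpoint_mem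
    (hF : ∀ x ∈ F, ∀ y ∈ F, midpoint ℝ x y ∈ F) (hint : (interior F).Nonempty) :
    interior (convexHull ℝ F) ⊆ F := by
  intro p hp
  obtain ⟨a, ha⟩ := hint
  obtain ⟨r, hr, hball⟩ := Metric.isOpen_iff.1 isOpen_interior a ha
  have hpc : p ∈ interior (closure F) :=
    interior_mono (convexHull_min subset_closure (convex_closure_of_midpoint_mem hF)) hp
  have hlim : Tendsto (fun k : ℕ => a + (1 - (2 : ℝ)⁻¹ ^ k)⁻¹ • (p - a)) atTop (𝓝 p) := by
    have h1 : Tendsto (fun k : ℕ => (2 : ℝ)⁻¹ ^ k) atTop (𝓝 0) :=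
      tendsto_pow_atTop_nhds_zero_of_lt_one (by norm_num) (by norm_num)
    have h2 := (tendsto_const_nhds (x := a)).add
      (((tendsto_const_nhds (x := (1 : ℝ)).sub h1).inv₀ (by norm_num)).smul_const (p - a))
    simpa using h2
  obtain ⟨k, hk, hk1⟩ := ((hlim.eventually_mem (isOpen_interior.mem_nhds hpc)).and
    (eventually_ge_atTop 1)).exists
  set t : ℝ := (2 : ℝ)⁻¹ ^ k with ht
  have ht0 : 0 < t := by positivity
  have ht1 : t < 1 := pow_lt_one₀ (by norm_num) (by norm_num) (by omega)
  have h1t : 0 < 1 - t := by linarith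
  obtain ⟨e, heF, he⟩ := Metric.mem_closure_iff.1 (interior_subset hk) (t * r / (1 - t))
    (by positivity)
  have hb : a + ((1 - t) / t) • (a + (1 - t)⁻¹ • (p - a) - e) ∈ F := by
    refine interior_subset (hball ?_)
    rw [mem_ball, dist_eq_norm, add_sub_cancel_left, norm_smul, ← dist_eq_norm,
      Real.norm_of_nonneg (by positivity)]
    calc (1 - t) / t * dist (a + (1 - t)⁻¹ • (p - a)) e
        < (1 - t) / t * (t * r / (1 - t)) := by gcongr
      _ = r := by field_simp
  convert lineMap_inv_two_pow_mem hF heF hb k using 1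
  rw [← ht, AffineMap.lineMap_apply_module]
  have h3 : t * ((1 - t) / t) = 1 - t := by field_simp
  have h4 : (1 - t) * (1 - t)⁻¹ = 1 := by field_simp
  rw [smul_add, smul_smul, h3, smul_sub, smul_add, smul_smul, h4]
  module

variable [MeasurableSpace V] [BorelSpace V]

/-- The translates of a midpoint convex set of positive finite Hausdorff measure by a
fixed multiple of a difference of two of its points meet it in uniformly large measure. -/
lemma exists_pos_le_hausdorffMeasure_inter_translate {s : ℝ} (hs : 0 < s)
    (hFm : MeasurableSet F) (hF : ∀ x ∈ F, ∀ y ∈ F, midpoint ℝ x y ∈ F)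
    (h0 : μH[s] F ≠ 0) (htop : μH[s] F ≠ ∞) :
    ∃ t : ℝ, 0 < t ∧ ∃ δ : ℝ≥0∞, 0 < δ ∧ ∀ y ∈ F, ∀ y' ∈ F,
      δ ≤ μH[s] {x ∈ F | x - t • (y' - y) ∈ F} := by
  have hlim : Tendsto (fun k : ℕ => (1 - (2 : ℝ)⁻¹ ^ k) ^ s) atTop (𝓝 1) := by
    have h1 : Tendsto (fun k : ℕ => (2 : ℝ)⁻¹ ^ k) atTop (𝓝 0) :=
      tendsto_pow_atTop_nhds_zero_of_lt_one (by norm_num) (by norm_num)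
    have h2 := (tendsto_const_nhds (x := (1 : ℝ)).sub h1).rpow_const (p := s) (by norm_num)
    simpa using h2
  obtain ⟨k, hk, hk1⟩ := ((hlim.eventually_const_lt (u := 1 / 2) (by norm_num)).and
    (eventually_ge_atTop 1)).exists
  set t : ℝ := (2 : ℝ)⁻¹ ^ k with ht
  have ht0 : 0 < t := by positivity
  have ht1 : t < 1 := pow_lt_one₀ (by norm_num) (by norm_num) (by omega)
  have h1t : 0 < 1 - t := by linarith
  set M := μH[s] F with hM
  set c : ℝ≥0∞ := ENNReal.ofReal ((1 - t) ^ s) with hcdef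
  have himg : ∀ y, μH[s] (AffineMap.homothety y (1 - t) '' F) = c * M := by
    intro y
    rw [hausdorffMeasure_homothety_image hs.le y h1t.ne', ENNReal.smul_def, smul_eq_mul, hcdef,
      ← ENNReal.ofReal_rpow_of_pos h1t, ENNReal.coe_rpow_of_nonneg _ hs.le, ← enorm_eq_nnnorm,
      Real.enorm_eq_ofReal h1t.le]
  have hmem : ∀ y ∈ F, AffineMap.homothety y (1 - t) '' F ⊆ F := by
    rintro y hy _ ⟨x, hx, rfl⟩
    convert lineMap_inv_two_pow_mem hF hx hy k using 1
    rw [← ht, AffineMap.lineMap_apply_module, AffineMap.homothety_apply, vsub_eq_sub, vadd_eq_add]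
    module
  have hmeas : ∀ y, MeasurableSet (AffineMap.homothety y (1 - t) '' F) := by
    intro y
    let e := (Homeomorph.addRight (-y)).trans
      ((Homeomorph.smulOfNeZero (1 - t) h1t.ne').trans (Homeomorph.addRight y))
    have he : ⇑(AffineMap.homothety y (1 - t)) = e := by
      ext x
      simp [e, AffineMap.homothety_apply, ← sub_eq_add_neg]
    rw [he]
    exact e.measurableEmbedding.measurableSet_image.2 hFm
  refine ⟨t, ht0, c * M + c * M - M, ?_, fun y hy y' hy' => ?_⟩
  · have hc : 1 < c + c := by
      rw [hcdef, ← ENNReal.ofReal_add (by positivity) (by positivity), ENNReal.one_lt_ofReal]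
      linarith
    rw [tsub_pos_iff_lt, ← add_mul]
    simpa using ENNReal.mul_lt_mul_left h0 htop hc
  · have hsub : AffineMap.homothety y (1 - t) '' F ∩ AffineMap.homothety y' (1 - t) '' F ⊆
        {x ∈ F | x - t • (y' - y) ∈ F} := by
      rintro x ⟨hx, z, hz, rfl⟩
      refine ⟨hmem y hy hx, ?_⟩
      convert hmem y hy ⟨z, hz, rfl⟩ using 1
      simp only [AffineMap.homothety_apply, vsub_eq_sub, vadd_eq_add]
      module
    rw [tsub_le_iff_right]
    calc c * M + c * M = μH[s] (AffineMap.homothety y (1 - t) '' F ∪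
          AffineMap.homothety y' (1 - t) '' F) + μH[s] (AffineMap.homothety y (1 - t) '' F ∩
          AffineMap.homothety y' (1 - t) '' F) := by
            rw [measure_union_add_inter _ (hmeas y'), himg, himg]
      _ ≤ M + μH[s] {x ∈ F | x - t • (y' - y) ∈ F} :=
          add_le_add (measure_mono (union_subset (hmem y hy) (hmem y' hy'))) (measure_mono hsub)
      _ = _ := add_comm _ _

end MidpointConvex

/-- If uniformly large parts of a set of finite Hausdorff measure return to the set under all
translations from `D`, then the same is true with positive measure for translations in the
closure of `D`. -/
lemma hausdorffMeasure_inter_translate_pos_of_mem_closure {V : Type*}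
    [NormedAddCommGroup V] [MeasurableSpace V] [BorelSpace V] {F : Set V} {s : ℝ}
    (hFm : MeasurableSet F) (htop : μH[s] F ≠ ∞) {D : Set V} {δ : ℝ≥0∞} (hδ : 0 < δ)
    (hD : ∀ v ∈ D, δ ≤ μH[s] {x ∈ F | x - v ∈ F}) {v : V} (hv : v ∈ closure D) :
    0 < μH[s] {x ∈ F | x - v ∈ F} := by
  have : IsFiniteMeasure ((μH[s] : Measure V).restrict F) := ⟨by simpa using htop.lt_top⟩
  set ε : ℝ≥0∞ := min δ 1 / 4 with hε
  have hm0 : min δ 1 ≠ 0 := (lt_min hδ one_pos).ne'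
  have hmtop : min δ 1 ≠ ∞ := ne_top_of_le_ne_top ENNReal.one_ne_top (min_le_right _ _)
  have hε0 : ε ≠ 0 := by simp [hε, ENNReal.div_eq_zero_iff, hδ.ne']
  have hεtop : ε ≠ ∞ := ENNReal.div_ne_top hmtop (by norm_num)
  have hε4 : ε + ε + ε < δ := by
    refine lt_of_lt_of_le ?_ (min_le_left δ 1)
    have h4 : ε + ε + ε + ε = min δ 1 := by
      calc ε + ε + ε + ε = 4 * (min δ 1 / 4) := by rw [hε]; ring
        _ = min δ 1 := ENNReal.mul_div_cancel (by norm_num) (by norm_num)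
    rw [← h4]
    exact ENNReal.lt_add_right (by finiteness) hε0
  obtain ⟨K, hKF, hK, hKε⟩ := hFm.exists_isClosed_sdiff_lt
    (μ := (μH[s] : Measure V).restrict F) (measure_ne_top _ _) hε0
  rw [Measure.restrict_apply (hFm.diff hK.measurableSet), inter_eq_left.2 sdiff_subset] at hKε
  have hKtop : μH[s] K ≠ ∞ := ne_top_of_le_ne_top htop (measure_mono hKF)
  by_contra! hcon
  have hzero : μH[s] {x ∈ K | x - v ∈ K} = 0 :=
    le_antisymm ((measure_mono fun _ hx => And.imp (@hKF _) (@hKF _) hx).trans hcon) zero_le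
  have : IsFiniteMeasure ((μH[s] : Measure V).restrict K) := ⟨by simpa using hKtop.lt_top⟩
  have hmsub : Measurable fun x : V => x - v := (continuous_id.sub continuous_const).measurable
  have hlim := tendsto_measure_cthickening_of_isClosed
    (μ := ((μH[s] : Measure V).restrict K).map (· - v)) ⟨1, one_pos, measure_ne_top _ _⟩ hK
  rw [Measure.map_apply hmsub hK.measurableSet,
    Measure.restrict_apply (hmsub hK.measurableSet), inter_comm] at hlim
  change Tendsto _ _ (𝓝 (μH[s] {x ∈ K | x - v ∈ K})) at hlim
  rw [hzero] at hlim
  have hlim' := (hlim.mono_left (nhdsWithin_le_nhds (s := Ioi 0))).eventually_lt_const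
    (pos_iff_ne_zero.2 hε0)
  obtain ⟨η, hη, hη0⟩ := (hlim'.and self_mem_nhdsWithin).exists
  rw [Measure.map_apply hmsub isClosed_cthickening.measurableSet,
    Measure.restrict_apply (hmsub isClosed_cthickening.measurableSet)] at hη
  obtain ⟨w, hw, hvw⟩ := Metric.mem_closure_iff.1 hv η hη0
  have hcover : {x ∈ F | x - w ∈ F} ⊆ (F \ K) ∪ IsometryEquiv.addRight w '' (F \ K) ∪
      ((fun x => x - v) ⁻¹' cthickening η K ∩ K) := by
    rintro x ⟨hx, hxw⟩
    by_cases hxK : x ∈ K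
    · by_cases hxwK : x - w ∈ K
      · refine Or.inr ⟨mem_cthickening_of_dist_le _ _ _ _ hxwK ?_, hxK⟩
        rw [dist_sub_left]
        exact hvw.le
      · exact Or.inl (Or.inr ⟨x - w, ⟨hxw, hxwK⟩, by simp⟩)
    · exact Or.inl (Or.inl ⟨hx, hxK⟩)
  refine lt_irrefl δ (lt_of_le_of_lt ?_ hε4)
  calc δ ≤ μH[s] {x ∈ F | x - w ∈ F} := hD w hw
    _ ≤ _ := (measure_mono hcover).trans
      ((measure_union_le _ _).trans (add_le_add_left (measure_union_le _ _) _))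
    _ ≤ ε + ε + ε := by
      rw [IsometryEquiv.hausdorffMeasure_image]
      gcongr

section Haar

variable {V : Type*} [NormedAddCommGroup V] [NormedSpace ℝ V] [FiniteDimensional ℝ V]
  [MeasurableSpace V] [BorelSpace V] {F : Set V}

/-- A measurable set carrying a finite measure for which a nonnull set of translations returns a
nonnull part of it to itself has positive Haar measure. -/
lemma addHaar_ne_zero_of_translate_pos (μ ν : Measure V) [IsFiniteMeasure μ] [ν.IsAddHaarMeasure]
    (hFm : MeasurableSet F) {U : Set V} (hU : ν U ≠ 0)
    (h : ∀ v ∈ U, μ {x | x - v ∈ F} ≠ 0) : ν F ≠ 0 := by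
  intro hF0
  have hS : MeasurableSet {q : V × V | q.2 - q.1 ∈ F} :=
    hFm.preimage (measurable_snd.sub measurable_fst)
  have h1 : (ν.prod μ) {q : V × V | q.2 - q.1 ∈ F} = 0 := by
    rw [← Measure.prod_swap, Measure.map_apply measurable_swap hS,
      Measure.measure_prod_null (measurable_swap hS)]
    refine Eventually.of_forall fun x => ?_
    change ν ((fun v => x - v) ⁻¹' F) = 0
    exact (quasiMeasurePreserving_sub_left ν x).preimage_null hF0
  have h2 := Measure.measure_ae_null_of_prod_null h1
  exact hU (measure_mono_null (fun v hv => h v hv) h2)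

/-- A midpoint convex measurable set of positive Haar measure has nonempty interior. -/
lemma interior_nonempty_of_midpoint_mem_of_addHaar_ne_zero (ν : Measure V) [ν.IsAddHaarMeasure]
    (hFm : MeasurableSet F) (hF : ∀ x ∈ F, ∀ y ∈ F, midpoint ℝ x y ∈ F) (h : ν F ≠ 0) :
    (interior F).Nonempty := by
  obtain ⟨c, hc⟩ : ∃ c, ν (F ∩ (fun x => c - x) ⁻¹' F) ≠ 0 := by
    by_contra! hcon
    have hS : MeasurableSet {q : V × V | q.1 ∈ F ∧ q.2 - q.1 ∈ F} :=
      (hFm.preimage measurable_fst).inter (hFm.preimage (measurable_snd.sub measurable_fst))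
    have h1 : (ν.prod ν) {q : V × V | q.1 ∈ F ∧ q.2 - q.1 ∈ F} = 0 := by
      rw [← Measure.prod_swap, Measure.map_apply measurable_swap hS,
        Measure.measure_prod_null (measurable_swap hS)]
      exact Eventually.of_forall hcon
    have h2 := Measure.measure_ae_null_of_prod_null h1
    refine h (measure_mono_null (fun x hx => ?_) h2)
    have : Prod.mk x ⁻¹' {q : V × V | q.1 ∈ F ∧ q.2 - q.1 ∈ F} = (fun y => y + (-x)) ⁻¹' F := by
      ext y
      simp [hx, sub_eq_add_neg]
    change ν (Prod.mk x ⁻¹' _) ≠ 0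
    rw [this, measure_preimage_add_right]
    exact h
  have hSm : MeasurableSet (F ∩ (fun x => c - x) ⁻¹' F) :=
    hFm.inter (hFm.preimage (measurable_const.sub measurable_id))
  have hnhds := Measure.sub_mem_nhds_zero_of_addHaar_pos ν _ hSm (pos_iff_ne_zero.2 hc)
  refine ⟨(2 : ℝ)⁻¹ • c, mem_interior_iff_mem_nhds.2 ?_⟩
  have hcont : Tendsto (fun z : V => (2 : ℝ) • z - c) (𝓝 ((2 : ℝ)⁻¹ • c)) (𝓝 0) := by
    have : Continuous fun z : V => (2 : ℝ) • z - c := by fun_prop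
    simpa using this.tendsto ((2 : ℝ)⁻¹ • c)
  filter_upwards [hcont hnhds] with z hz
  obtain ⟨x, hx, y, hy, hxy⟩ := hz
  convert hF x hx.1 (c - y) hy.2 using 1
  have hz' : z = (2 : ℝ)⁻¹ • (x - y + c) := by
    simp only at hxy
    rw [hxy]
    module
  rw [hz', midpoint_eq_smul_add, invOf_eq_inv]
  module

/-- A midpoint convex Borel set that affinely spans the space and has positive finite Hausdorff
measure of some positive dimension has nonempty interior. -/
theorem interior_nonempty_of_midpoint_mem_of_hausdorffMeasure {s : ℝ} (hs : 0 < s)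
    (hFm : MeasurableSet F) (hF : ∀ x ∈ F, ∀ y ∈ F, midpoint ℝ x y ∈ F)
    (hspan : affineSpan ℝ F = ⊤) (h0 : μH[s] F ≠ 0) (htop : μH[s] F ≠ ∞) :
    (interior F).Nonempty := by
  obtain ⟨t, ht, δ, hδ, hδF⟩ := exists_pos_le_hausdorffMeasure_inter_translate hs hFm hF h0 htop
  obtain ⟨a, ha⟩ := interior_convexHull_nonempty_iff_affineSpan_eq_top.2 hspan
  have haF : closure F ∈ 𝓝 a := mem_of_superset (mem_interior_iff_mem_nhds.1 ha)
    (convexHull_min subset_closure (convex_closure_of_midpoint_mem hF))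
  let g : V → V → V := fun y y' => t • (y' - y)
  have hg : Continuous (Function.uncurry g) := by
    simp only [g, Function.uncurry_def]
    fun_prop
  have hU : closure (image2 g F F) ∈ 𝓝 (0 : V) := by
    have hcont : Tendsto (fun v : V => a + t⁻¹ • v) (𝓝 0) (𝓝 a) := by
      have : Continuous fun v : V => a + t⁻¹ • v := by fun_prop
      simpa using this.tendsto 0
    filter_upwards [hcont haF] with v hv
    have := map_mem_closure₂ hg (mem_of_mem_nhds haF) hv fun y hy y' hy' =>
      mem_image2_of_mem hy hy'
    simpa [g, ht.ne'] using this
  have hpos : ∀ v ∈ closure (image2 g F F), 0 < μH[s] {x ∈ F | x - v ∈ F} := fun v hv =>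
    hausdorffMeasure_inter_translate_pos_of_mem_closure hFm htop hδ
      (by rintro _ ⟨y, hy, y', hy', rfl⟩; exact hδF y hy y' hy') hv
  have : IsFiniteMeasure ((μH[s] : Measure V).restrict F) := ⟨by simpa using htop.lt_top⟩
  refine interior_nonempty_of_midpoint_mem_of_addHaar_ne_zero Measure.addHaar hFm hF
    (addHaar_ne_zero_of_translate_pos ((μH[s] : Measure V).restrict F) Measure.addHaar hFm
      (Measure.measure_pos_of_mem_nhds _ hU).ne' fun v hv => ?_)
  have hm : MeasurableSet {x | x - v ∈ F} := hFm.preimage (measurable_id.sub_const v)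
  rw [Measure.restrict_apply hm, inter_comm]
  exact (hpos v hv).ne'

end Haar

theorem hausdorff_measure_zero_or_infty_of_midpointConvex_not_essentiallyConvex
    (d : ℕ) (s : ℝ) (hs : 0 < s) (hsd : s < d)
    (E : Set (EuclideanSpace ℝ (Fin d))) (hE : MeasurableSet E)
    (hmid : MidpointConvexSet E) (hnec : ¬ EssentiallyConvex E) :
    μH[s] E = 0 ∨ μH[s] E = ∞ := by
  by_contra! hcon
  obtain ⟨h0, htop⟩ := hcon
  obtain ⟨p, hp⟩ := nonempty_of_measure_ne_zero h0
  refine hnec ?_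
  set L := affineSpan ℝ E with hL
  have hEL : E ⊆ L := subset_affineSpan ℝ E
  let pL : L := ⟨p, hEL hp⟩
  have : Nonempty L := ⟨pL⟩
  let e : L.direction ≃ᵃⁱ[ℝ] L := AffineIsometryEquiv.vaddConst ℝ pL
  let j : L.direction →ᵃ[ℝ] EuclideanSpace ℝ (Fin d) :=
    L.subtype.comp e.toAffineEquiv.toAffineMap
  have hj : Isometry j := isometry_subtype_coe.comp e.isometry
  have hje : ∀ w, j w = (e w : EuclideanSpace ℝ (Fin d)) := fun w => rfl
  set F : Set L.direction := j ⁻¹' E with hFdef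
  have hjF : j '' F = E := by
    refine image_preimage_eq_of_subset fun x hx => ⟨e.symm ⟨x, hEL hx⟩, ?_⟩
    rw [hje, e.apply_symm_apply]
  have hjr : range j = L := by
    ext x
    refine ⟨?_, fun hx => ⟨e.symm ⟨x, hx⟩, by rw [hje, e.apply_symm_apply]⟩⟩
    rintro ⟨w, rfl⟩
    exact (e w).2
  have hFm : MeasurableSet F := hE.preimage hj.continuous.measurable
  have hFmid : ∀ x ∈ F, ∀ y ∈ F, midpoint ℝ x y ∈ F := fun x hx y hy => by
    rw [hFdef, mem_preimage, j.map_midpoint]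
    exact hmid _ hx _ hy
  have hHF : μH[s] F = μH[s] E := by
    rw [← hjF, hj.hausdorffMeasure_image (Or.inl hs.le)]
  have hspan : affineSpan ℝ F = ⊤ := by
    refine SetLike.coe_injective (hj.injective.image_injective ?_)
    change j '' (affineSpan ℝ F) = j '' univ
    rw [← AffineSubspace.coe_map, AffineSubspace.map_span, hjF, image_univ, hjr]
  have hint : (interior F).Nonempty := interior_nonempty_of_midpoint_mem_of_hausdorffMeasure hs hFm
    hFmid hspan (hHF ▸ h0) (hHF ▸ htop)
  have hFe : F = e.toHomeomorph ⁻¹' (Subtype.val ⁻¹' E) := rfl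
  have hconv : convexHull ℝ F = e.toHomeomorph ⁻¹' (Subtype.val ⁻¹' convexHull ℝ E) := by
    change _ = j ⁻¹' convexHull ℝ E
    rw [← hjF, ← j.image_convexHull, preimage_image_eq _ hj.injective]
  refine ⟨Module.finrank ℝ L.direction, ?_, ?_, L, rfl, hEL, ?_, ?_⟩
  · rw [Nat.one_le_iff_ne_zero]
    intro hfin
    have := Module.finrank_zero_iff.1 hfin
    have := Measure.nullSingletonClass_hausdorff L.direction hs
    exact h0 (hHF ▸ (subsingleton_of_subsingleton (s := F)).measure_zero μH[s])
  · simpa using L.direction.finrank_le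
  · obtain ⟨w, hw⟩ := hint
    rw [hFe, ← e.toHomeomorph.preimage_interior] at hw
    exact ⟨_, hw⟩
  · rintro l ⟨hl, hlE⟩
    obtain ⟨w, rfl⟩ := e.toHomeomorph.surjective l
    rw [← mem_preimage, e.toHomeomorph.preimage_frontier, ← hconv]
    refine ⟨subset_closure (hconv ▸ hl), fun hw => hlE ?_⟩
    exact interior_convexHull_subset_of_midpoint_mem hFmid hint hw
end

section
/- Let 0 < s < d and let E ⊆ ℝ^d be a Borel set that is mid-point convex and satisfies 0 < H^s(E) < ∞. Then s is an integer. -/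
open MeasureTheory Set Metric Filter
open scoped ENNReal

open scoped Topology

section TranslationDefect

variable {V : Type*} [NormedAddCommGroup V] [MeasurableSpace V]

/-- The `μ`-measure of the part of `E` lost by translating `E` by `w`. -/
noncomputable def translationDefect (μ : Measure V) (E : Set V) (w : V) : ℝ≥0∞ :=
  μ (E \ (fun x => x - w) ⁻¹' E)

theorem translationDefect_zero (μ : Measure V) (E : Set V) : translationDefect μ E 0 = 0 := by
  simp [translationDefect]

variable [BorelSpace V]

theorem translationDefect_add_le (μ : Measure V) [μ.IsAddRightInvariant] (E : Set V) (w w' : V) :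
    translationDefect μ E (w + w') ≤ translationDefect μ E w + translationDefect μ E w' := by
  have hsub : E \ (fun x => x - (w + w')) ⁻¹' E ⊆
      (E \ (fun x => x - w) ⁻¹' E) ∪ (fun x => x + -w) ⁻¹' (E \ (fun x => x - w') ⁻¹' E) := by
    rintro x ⟨hx, hx'⟩
    by_cases h : x - w ∈ E
    · refine Or.inr ⟨by simpa [sub_eq_add_neg] using h, fun h' => hx' ?_⟩
      have h'' : x + -w - w' ∈ E := h'
      have : x - (w + w') = x + -w - w' := by abel
      simpa [this] using h''
    · exact Or.inl ⟨hx, h⟩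
  refine (measure_mono hsub).trans ((measure_union_le _ _).trans ?_)
  rw [measure_preimage_add_right]
  rfl

theorem translationDefect_nsmul_le (μ : Measure V) [μ.IsAddRightInvariant] (E : Set V) (w : V)
    (m : ℕ) : translationDefect μ E (m • w) ≤ m * translationDefect μ E w := by
  induction m with
  | zero => simp [translationDefect_zero]
  | succ m ih =>
    rw [succ_nsmul]
    refine (translationDefect_add_le μ E _ _).trans ?_
    push_cast
    rw [add_mul, one_mul]
    gcongr

theorem translationDefect_sum_le (μ : Measure V) [μ.IsAddRightInvariant] (E : Set V)
    {ι : Type*} (S : Finset ι) (w : ι → V) :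
    translationDefect μ E (∑ i ∈ S, w i) ≤ ∑ i ∈ S, translationDefect μ E (w i) := by
  classical
  induction S using Finset.induction_on with
  | empty => simp [translationDefect_zero]
  | insert a S ha ih =>
    rw [Finset.sum_insert ha, Finset.sum_insert ha]
    refine (translationDefect_add_le μ E _ _).trans ?_
    gcongr

/-- For a finite measure, the measure of the translates of a closed set is upper semicontinuous
in the translation. -/
theorem le_measure_translate_of_tendsto (μ : Measure V) [IsFiniteMeasure μ] {K : Set V}
    (hK : IsClosed K) {c : ℝ≥0∞} {u : ℕ → V} {v : V} (hu : Tendsto u atTop (𝓝 v))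
    (hc : ∀ n, c ≤ μ ((fun x => x - u n) ⁻¹' K)) : c ≤ μ ((fun x => x - v) ⁻¹' K) := by
  have hcl : IsClosed ((fun x => x - v) ⁻¹' K) := hK.preimage (by fun_prop)
  have h1 := tendsto_measure_cthickening_of_isClosed (μ := μ)
    ⟨1, one_pos, measure_ne_top _ _⟩ hcl
  have h2 : Tendsto (fun n => dist (u n) v) atTop (𝓝 0) := tendsto_iff_dist_tendsto_zero.1 hu
  refine ge_of_tendsto' (h1.comp h2) fun n => (hc n).trans (measure_mono fun x hx => ?_)
  refine mem_cthickening_of_dist_le x (x - u n + v) _ _ ?_ ?_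
  · simpa using hx
  · have h : x - (x - u n + v) = u n - v := by abel
    simp only [dist_eq_norm, h, le_refl]

end TranslationDefect

section MidpointConvex

variable {d : ℕ}

theorem MidpointConvexSet.homothety_image_subset {E : Set (EuclideanSpace ℝ (Fin d))}
    (hE : MidpointConvexSet E) {p : EuclideanSpace ℝ (Fin d)} (hp : p ∈ E) (n : ℕ) :
    AffineMap.homothety p (1 - (1 / 2 : ℝ) ^ n) '' E ⊆ E := by
  induction n with
  | zero => rintro _ ⟨x, -, rfl⟩; simpa using hp
  | succ n ih =>
    rintro _ ⟨x, hx, rfl⟩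
    have h := hE _ hx _ (ih ⟨x, hx, rfl⟩)
    convert h using 1
    simp only [AffineMap.homothety_apply, midpoint_eq_smul_add, vsub_eq_sub, vadd_eq_add,
      invOf_eq_inv]
    module

theorem MidpointConvexSet.translationDefect_le {E : Set (EuclideanSpace ℝ (Fin d))}
    (hmid : MidpointConvexSet E) (hE : MeasurableSet E) {s : ℝ} (hs : 0 < s) (hsd : s ≤ d)
    (hfin : μH[s] E < ∞) {p q : EuclideanSpace ℝ (Fin d)} (hp : p ∈ E) (hq : q ∈ E) (n : ℕ) :
    translationDefect μH[s] E ((1 / 2 : ℝ) ^ (n + 1) • (q - p)) ≤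
      ENNReal.ofReal (d * (1 / 2 : ℝ) ^ (n + 1)) * μH[s] E := by
  set ε : ℝ := (1 / 2 : ℝ) ^ (n + 1) with hε
  have hε0 : 0 < ε := by positivity
  have hε1 : ε < 1 := pow_lt_one₀ (by norm_num) (by norm_num) (by omega)
  have hc : 0 < 1 - ε := by linarith
  set F := AffineMap.homothety q (1 - ε) '' E with hF
  have hFE : F ⊆ E := hmid.homothety_image_subset hq (n + 1)
  have hpE := hmid.homothety_image_subset hp (n + 1)
  have hFtrans : F ⊆ (fun x => x - ε • (q - p)) ⁻¹' E := by
    rintro _ ⟨x, hx, rfl⟩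
    have h := hpE ⟨x, hx, rfl⟩
    rw [mem_preimage]
    convert h using 1
    simp only [AffineMap.homothety_apply, vsub_eq_sub, vadd_eq_add, ← hε]
    module
  have hFmeas : MeasurableSet F := by
    refine hE.image_of_continuousOn_injOn (AffineMap.homothety_continuous q _).continuousOn ?_
    intro x _ y _ hxy
    simpa [AffineMap.homothety_apply, hc.ne'] using hxy
  have hFmass : μH[s] F = ENNReal.ofReal ((1 - ε) ^ s) * μH[s] E := by
    rw [hF, hausdorffMeasure_homothety_image hs.le q hc.ne' E, ENNReal.smul_def, smul_eq_mul]
    congr 1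
    rw [← ENNReal.ofReal_coe_nnreal, NNReal.coe_rpow, coe_nnnorm, Real.norm_of_nonneg hc.le]
  have hpow : 1 - d * ε ≤ (1 - ε) ^ s := by
    have h1 : (1 - ε) ^ (d : ℝ) ≤ (1 - ε) ^ s :=
      Real.rpow_le_rpow_of_exponent_ge hc (by linarith) hsd
    rw [Real.rpow_natCast] at h1
    have h2 := one_add_mul_le_pow (a := -ε) (by linarith) d
    have h3 : 1 + -ε = 1 - ε := by ring
    rw [h3] at h2
    linarith
  calc translationDefect μH[s] E (ε • (q - p)) ≤ μH[s] (E \ F) :=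
        measure_mono (sdiff_subset_sdiff_right hFtrans)
    _ = μH[s] E - μH[s] F := measure_sdiff hFE hFmeas.nullMeasurableSet
        (ne_top_of_le_ne_top hfin.ne (measure_mono hFE))
    _ ≤ ENNReal.ofReal (d * ε) * μH[s] E := by
        rw [tsub_le_iff_right, hFmass, ← add_mul, ← ENNReal.ofReal_add (by positivity)
          (by positivity)]
        calc μH[s] E = ENNReal.ofReal 1 * μH[s] E := by simp
          _ ≤ _ := by gcongr; linarith

theorem MidpointConvexSet.translationDefect_sum_le {E : Set (EuclideanSpace ℝ (Fin d))}
    (hmid : MidpointConvexSet E) (hE : MeasurableSet E) {s : ℝ} (hs : 0 < s) (hsd : s ≤ d)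
    (hfin : μH[s] E < ∞) {p : EuclideanSpace ℝ (Fin d)} (hp : p ∈ E)
    {ι : Type*} [Fintype ι] {v : ι → EuclideanSpace ℝ (Fin d)} (hv : ∀ i, p + v i ∈ E)
    {τ : ℝ} {n : ℕ} {m : ι → ℕ} (hm : ∀ i, m i * (1 / 2 : ℝ) ^ (n + 1) ≤ τ) :
    translationDefect μH[s] E (∑ i, (m i * (1 / 2 : ℝ) ^ (n + 1)) • v i) ≤
      ENNReal.ofReal (Fintype.card ι * (d * τ)) * μH[s] E := by
  refine (_root_.translationDefect_sum_le μH[s] E _ _).trans ?_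
  have key : ∀ i, translationDefect μH[s] E ((m i * (1 / 2 : ℝ) ^ (n + 1)) • v i) ≤
      ENNReal.ofReal (d * τ) * μH[s] E := by
    intro i
    have h1 := hmid.translationDefect_le hE hs hsd hfin hp (hv i) n
    rw [add_sub_cancel_left] at h1
    rw [mul_smul, Nat.cast_smul_eq_nsmul]
    refine (translationDefect_nsmul_le μH[s] E _ _).trans ?_
    calc (m i : ℝ≥0∞) * translationDefect μH[s] E ((1 / 2 : ℝ) ^ (n + 1) • v i)
        ≤ ENNReal.ofReal (m i) * (ENNReal.ofReal (d * (1 / 2 : ℝ) ^ (n + 1)) * μH[s] E) := by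
          rw [ENNReal.ofReal_natCast]; gcongr
      _ = ENNReal.ofReal (d * (m i * (1 / 2 : ℝ) ^ (n + 1))) * μH[s] E := by
          rw [← mul_assoc, ← ENNReal.ofReal_mul (by positivity)]
          congr 2; ring
      _ ≤ _ := by gcongr; exact hm i
  refine (Finset.sum_le_sum fun i _ => key i).trans ?_
  rw [Finset.sum_const, Finset.card_univ, nsmul_eq_mul,
    ENNReal.ofReal_mul (Nat.cast_nonneg (Fintype.card ι)), ENNReal.ofReal_natCast, mul_assoc]

/-- A midpoint convex set of positive and finite `s`-dimensional measure which contains a point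
together with its translates by `k` linearly independent vectors satisfies `k ≤ s`. -/
theorem MidpointConvexSet.card_le {E : Set (EuclideanSpace ℝ (Fin d))}
    (hmid : MidpointConvexSet E) (hE : MeasurableSet E) {s : ℝ} (hs : 0 < s) (hsd : s ≤ d)
    (hpos : 0 < μH[s] E) (hfin : μH[s] E < ∞) {p : EuclideanSpace ℝ (Fin d)} (hp : p ∈ E)
    {ι : Type*} [Fintype ι] {v : ι → EuclideanSpace ℝ (Fin d)} (hv : ∀ i, p + v i ∈ E)
    (hli : LinearIndependent ℝ v) : (Fintype.card ι : ℝ) ≤ s := by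
  by_contra! hlt
  set μ : Measure (EuclideanSpace ℝ (Fin d)) := μH[s].restrict E with hμ
  have : IsFiniteMeasure μ := ⟨by simpa [hμ] using hfin⟩
  have hne : μH[s] E / 4 ≠ 0 := ENNReal.div_ne_zero.2 ⟨hpos.ne', by norm_num⟩
  obtain ⟨K, hKE, hK, hKlt⟩ := hE.exists_isClosed_lt_add (μ := μ) (measure_ne_top _ _) hne
  have hμE : μ E = μH[s] E := by simp [hμ]
  rw [hμE] at hKlt
  have hμK : μ K = μH[s] K := by
    rw [hμ, Measure.restrict_apply hK.measurableSet, inter_eq_self_of_subset_left hKE]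
  rw [hμK] at hKlt
  have hEK : μH[s] (E \ K) < μH[s] E / 4 :=
    measure_sdiff_lt_of_lt_add hK.nullMeasurableSet hKE
      (ne_top_of_le_ne_top hfin.ne (measure_mono hKE)) hKlt
  -- the linear parametrization of the span of the `v i`
  set T : (ι → ℝ) →ₗ[ℝ] EuclideanSpace ℝ (Fin d) := Fintype.linearCombination ℝ v with hT
  have hTc : Continuous T := T.continuous_of_finiteDimensional
  obtain ⟨C, -, hC⟩ := T.exists_antilipschitzWith
    (LinearMap.ker_eq_bot.2 (hli.fintypeLinearCombination_injective))
  set τ : ℝ := 1 / (4 * (Fintype.card ι * d + 1)) with hτ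
  have hτ0 : 0 < τ := by positivity
  have hkτ : Fintype.card ι * (d * τ) ≤ 1 / 4 := by
    rw [hτ, ← mul_assoc, mul_one_div, div_le_div_iff₀ (by positivity) (by norm_num)]
    nlinarith
  have hbox : ∀ t ∈ Set.pi univ (fun _ : ι => Icc 0 τ),
      μH[s] E / 2 ≤ μ ((fun x => x - T t) ⁻¹' K) := by
    intro t ht
    set m : ℕ → ι → ℕ := fun n i => ⌊t i * 2 ^ (n + 1)⌋₊
    have htend : Tendsto (fun n => T fun i => m n i * (1 / 2 : ℝ) ^ (n + 1)) atTop (𝓝 (T t)) := by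
      refine (hTc.tendsto t).comp (tendsto_pi_nhds.2 fun i => ?_)
      have h2 : Tendsto (fun n : ℕ => (2 : ℝ) ^ (n + 1)) atTop atTop :=
        (tendsto_pow_atTop_atTop_of_one_lt (by norm_num)).comp (tendsto_add_atTop_nat 1)
      have h3 := (tendsto_nat_floor_mul_div_atTop (ht i (mem_univ i)).1).comp h2
      refine h3.congr fun n => ?_
      simp [m, div_eq_mul_inv]
    refine le_measure_translate_of_tendsto μ hK htend fun n => ?_
    set w := T fun i => m n i * (1 / 2 : ℝ) ^ (n + 1) with hw
    have hdef : translationDefect μH[s] E w ≤ μH[s] E / 4 := by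
      have h := hmid.translationDefect_sum_le hE hs hsd hfin hp hv (τ := τ) (n := n)
        (m := m n) ?_
      · rw [hw, hT, Fintype.linearCombination_apply]
        refine h.trans ?_
        calc _ ≤ ENNReal.ofReal (1 / 4) * μH[s] E := by gcongr
          _ = μH[s] E / 4 := by
            rw [ENNReal.ofReal_div_of_pos (by norm_num), ENNReal.div_eq_inv_mul (b := 4)]
            simp
      · intro i
        have h1 : (m n i : ℝ) ≤ t i * 2 ^ (n + 1) :=
          Nat.floor_le (mul_nonneg (ht i (mem_univ i)).1 (by positivity))
        calc (m n i : ℝ) * (1 / 2 : ℝ) ^ (n + 1)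
            ≤ t i * 2 ^ (n + 1) * (1 / 2 : ℝ) ^ (n + 1) := by gcongr
          _ = t i := by rw [mul_assoc, ← mul_pow]; norm_num
          _ ≤ τ := (ht i (mem_univ i)).2
    have hsub : E ⊆ ((fun x => x - w) ⁻¹' K ∩ E) ∪ ((E \ (fun x => x - w) ⁻¹' E) ∪
        (fun x => x + -w) ⁻¹' (E \ K)) := by
      intro x hx
      by_cases h1 : x - w ∈ K
      · exact Or.inl ⟨h1, hx⟩
      by_cases h2 : x - w ∈ E
      · exact Or.inr (Or.inr ⟨by simpa [sub_eq_add_neg] using h2,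
          by simpa [sub_eq_add_neg] using h1⟩)
      · exact Or.inr (Or.inl ⟨hx, h2⟩)
    have hmeas : MeasurableSet ((fun x => x - w) ⁻¹' K) :=
      (hK.preimage (by fun_prop)).measurableSet
    have h4 : μH[s] E ≤ μ ((fun x => x - w) ⁻¹' K) + (μH[s] E / 4 + μH[s] E / 4) := by
      refine (measure_mono hsub).trans ((measure_union_le _ _).trans ?_)
      rw [hμ, Measure.restrict_apply hmeas]
      gcongr
      refine (measure_union_le _ _).trans ?_
      rw [measure_preimage_add_right]
      exact add_le_add hdef hEK.le
    have hhalf : μH[s] E / 4 + μH[s] E / 4 = μH[s] E / 2 := by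
      have h24 : (4 : ℝ≥0∞)⁻¹ = 2⁻¹ * 2⁻¹ := by
        rw [← ENNReal.mul_inv (by simp) (by simp)]; norm_num
      rw [← ENNReal.add_halves (μH[s] E / 2)]
      simp only [div_eq_mul_inv, h24, mul_assoc]
    rw [hhalf] at h4
    rw [← tsub_le_iff_right, ENNReal.sub_half hfin.ne] at h4
    exact h4
  -- by Fubini, almost every translate of `K` along the span is null
  have hnull : ∀ᵐ t : ι → ℝ, ∀ᵐ x ∂μ, x - T t ∉ K := by
    rw [Measure.ae_ae_comm]
    · refine Eventually.of_forall fun x => ?_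
      rw [ae_iff]
      simp only [not_not]
      have hanti : AntilipschitzWith C fun t => x - T t := by
        intro a b
        simpa using hC a b
      have hKs : μH[(Fintype.card ι : ℝ)] K = 0 :=
        (Measure.hausdorffMeasure_zero_or_top hlt K).resolve_right
          (ne_top_of_le_ne_top hfin.ne (measure_mono hKE))
      have h := hanti.hausdorffMeasure_preimage_le (Nat.cast_nonneg (Fintype.card ι)) K
      rw [hKs, mul_zero, hausdorffMeasure_pi_real] at h
      exact le_antisymm h bot_le
    · exact ((hK.preimage (f := fun z : (ι → ℝ) × EuclideanSpace ℝ (Fin d) => z.2 - T z.1)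
        (by fun_prop)).measurableSet).compl
  have hboxnull : volume (Set.pi univ (fun _ : ι => Icc 0 τ)) = 0 := by
    refine measure_mono_null (fun t ht => ?_) (ae_iff.1 hnull)
    intro h0
    have h1 : μ ((fun x => x - T t) ⁻¹' K) = 0 := by
      simpa [ae_iff, preimage] using h0
    have h2 := hbox t ht
    rw [h1] at h2
    exact ENNReal.div_ne_zero.2 ⟨hpos.ne', by norm_num⟩ (le_antisymm h2 bot_le)
  rw [volume_pi_pi] at hboxnull
  simp [hτ0.not_ge] at hboxnull

end MidpointConvex

theorem integer_dimension_of_midpointConvex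
    (d : ℕ) (s : ℝ) (hs : 0 < s) (hsd : s < d)
    (E : Set (EuclideanSpace ℝ (Fin d))) (hE : MeasurableSet E)
    (hmid : MidpointConvexSet E)
    (hpos : 0 < μH[s] E) (hfin : μH[s] E < ∞) :
    ∃ n : ℤ, s = n := by
  lift s to NNReal using hs.le
  obtain ⟨p, hp⟩ : E.Nonempty := nonempty_of_measure_ne_zero hpos.ne'
  obtain ⟨b, hbE, hspan, hli⟩ := exists_linearIndependent ℝ ((fun v => p + v) ⁻¹' E)
  have : Fintype b := @Fintype.ofFinite _ hli.finite
  refine ⟨Fintype.card b, le_antisymm ?_ ?_⟩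
  · by_contra! hlt
    set T : (b → ℝ) →ₗ[ℝ] EuclideanSpace ℝ (Fin d) := Fintype.linearCombination ℝ (↑) with hT
    have hrange : E ⊆ range fun t => p + T t := by
      intro x hx
      have hmem : x - p ∈ Submodule.span ℝ b := by
        rw [hspan]
        exact Submodule.subset_span (by simpa using hx)
      rw [← Subtype.range_coe (s := b), ← Fintype.range_linearCombination ℝ, ← hT] at hmem
      obtain ⟨t, ht⟩ := hmem
      exact ⟨t, by simp [ht]⟩
    obtain ⟨C, hC⟩ : ∃ C, LipschitzWith C fun t => p + T t :=
      ⟨_, (LipschitzWith.const p).add (LinearMap.toContinuousLinearMap T).lipschitz⟩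
    have hdim : dimH E ≤ Fintype.card b := by
      rw [← Real.dimH_univ_pi]
      exact (dimH_mono hrange).trans hC.dimH_range_le
    refine hpos.ne' (hausdorffMeasure_of_dimH_lt (hdim.trans_lt ?_))
    rw [← ENNReal.coe_natCast, ENNReal.coe_lt_coe, ← NNReal.coe_lt_coe]
    simpa using hlt
  · simpa using hmid.card_le hE hs hsd.le hpos hfin hp (fun i : b => hbE i.2) hli
end

section
/- For every s with 0 < s < d there exists a Borel set E₁ ⊆ ℝ^d of Hausdorff dimension s that is mid-point convex but not essentially convex and satisfies H^s(E₁) = 0. -/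
open MeasureTheory Set Metric Filter
open scoped ENNReal

theorem summable_of_abs_le_half_pow {t : ℕ → ℝ} {b : ℕ → ℕ} (hb : StrictMono b)
    (ht : ∀ j, |t j| ≤ (1 / 2) ^ b j) : Summable t :=
  Summable.of_norm_bounded (g := fun j => (1 / 2 : ℝ) ^ j) summable_geometric_two fun j =>
    (ht j).trans (pow_le_pow_of_le_one (by norm_num) (by norm_num) (hb.id_le j))

theorem abs_tsum_add_le_two_mul_half_pow {t : ℕ → ℝ} {b : ℕ → ℕ} (hb : StrictMono b)
    (ht : ∀ j, |t j| ≤ (1 / 2) ^ b j) (k : ℕ) :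
    |∑' j, t (j + k)| ≤ 2 * (1 / 2) ^ b k := by
  have hs : HasSum (fun j => (1 / 2 : ℝ) ^ b k * (1 / 2) ^ j) ((1 / 2) ^ b k * 2) :=
    hasSum_geometric_two.mul_left _
  have := tsum_of_norm_bounded (f := fun j => t (j + k)) hs fun j => by
    refine (ht (j + k)).trans ?_
    rw [← pow_add]
    refine pow_le_pow_of_le_one (by norm_num) (by norm_num) ?_
    have := hb.add_le_nat j k
    omega
  rwa [Real.norm_eq_abs, mul_comm] at this

/-- The number of binary positions up to `a k` outside the gaps `(a j, b j]`. -/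
def freeCount (a b : ℕ → ℕ) : ℕ → ℕ
  | 0 => 0
  | k + 1 => freeCount a b k + (a (k + 1) - b k)

/-- The `j`-th block of binary digits of `x`, of length `a (j + 1) - b j`. -/
noncomputable def digitBlock (a b : ℕ → ℕ) (x : ℝ) (j : ℕ) : ℤ :=
  ⌊2 ^ freeCount a b (j + 1) * x⌋ - 2 ^ (a (j + 1) - b j) * ⌊2 ^ freeCount a b j * x⌋

/-- The real number whose binary digits at positions outside the gaps `(a j, b j]` are the
successive binary digits of `x`, and whose digits inside the gaps vanish. -/
noncomputable def spread (a b : ℕ → ℕ) (x : ℝ) : ℝ :=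
  ∑' j, (digitBlock a b x j : ℝ) / 2 ^ a (j + 1)

theorem digitBlock_nonneg (a b : ℕ → ℕ) (x : ℝ) (j : ℕ) : 0 ≤ digitBlock a b x j := by
  rw [digitBlock, sub_nonneg, Int.le_floor, freeCount, pow_add]
  push_cast
  have := Int.floor_le (2 ^ freeCount a b j * x)
  have h2 : (0 : ℝ) < 2 ^ (a (j + 1) - b j) := by positivity
  nlinarith

theorem digitBlock_lt (a b : ℕ → ℕ) (x : ℝ) (j : ℕ) :
    digitBlock a b x j < 2 ^ (a (j + 1) - b j) := by
  rw [digitBlock, sub_lt_iff_lt_add, Int.floor_lt, freeCount, pow_add]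
  push_cast
  have := Int.lt_floor_add_one (2 ^ freeCount a b j * x)
  have h2 : (0 : ℝ) < 2 ^ (a (j + 1) - b j) := by positivity
  nlinarith

section spread

variable {a b : ℕ → ℕ}

theorem two_pow_sub_div_two_pow {m n : ℕ} (h : n < m) :
    (2 : ℝ) ^ (m - n) / 2 ^ m = (1 / 2) ^ n := by
  obtain ⟨e, rfl⟩ := Nat.exists_eq_add_of_lt h
  rw [show n + e + 1 - n = e + 1 by omega, one_div_pow]
  field_simp
  ring

theorem abs_digitBlock_div_le (hab : ∀ k, b k < a (k + 1)) (x : ℝ) (j : ℕ) :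
    |(digitBlock a b x j : ℝ) / 2 ^ a (j + 1)| ≤ (1 / 2) ^ b j := by
  have h0 : (0 : ℝ) ≤ digitBlock a b x j := by exact_mod_cast digitBlock_nonneg a b x j
  have h1 : (digitBlock a b x j : ℝ) ≤ 2 ^ (a (j + 1) - b j) := by
    exact_mod_cast (digitBlock_lt a b x j).le
  rw [abs_of_nonneg (by positivity), ← two_pow_sub_div_two_pow (hab j)]
  gcongr

theorem abs_digitBlock_sub_div_le (hab : ∀ k, b k < a (k + 1)) (x y : ℝ) (j : ℕ) :
    |((digitBlock a b x j : ℝ) - digitBlock a b y j) / 2 ^ a (j + 1)| ≤ (1 / 2) ^ b j := by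
  have h0 : (0 : ℝ) ≤ digitBlock a b x j := by exact_mod_cast digitBlock_nonneg a b x j
  have h1 : (digitBlock a b x j : ℝ) ≤ 2 ^ (a (j + 1) - b j) := by
    exact_mod_cast (digitBlock_lt a b x j).le
  have h2 : (0 : ℝ) ≤ digitBlock a b y j := by exact_mod_cast digitBlock_nonneg a b y j
  have h3 : (digitBlock a b y j : ℝ) ≤ 2 ^ (a (j + 1) - b j) := by
    exact_mod_cast (digitBlock_lt a b y j).le
  rw [abs_div, abs_of_pos (by positivity : (0 : ℝ) < 2 ^ a (j + 1)),
    ← two_pow_sub_div_two_pow (hab j)]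
  gcongr
  rw [abs_le]
  constructor <;> linarith

theorem exists_abs_spread_sub_le (ha : Monotone a) (hb : StrictMono b)
    (hab : ∀ k, b k < a (k + 1)) (x : ℝ) (k : ℕ) :
    ∃ p : ℤ, |spread a b x - p / 2 ^ a k| ≤ 2 * (1 / 2) ^ b k := by
  refine ⟨∑ j ∈ Finset.range k, digitBlock a b x j * 2 ^ (a k - a (j + 1)), ?_⟩
  have hsum := summable_of_abs_le_half_pow hb (abs_digitBlock_div_le hab x)
  have htail := abs_tsum_add_le_two_mul_half_pow hb (abs_digitBlock_div_le hab x) k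
  have hsplit := hsum.sum_add_tsum_nat_add k
  have hint : ((∑ j ∈ Finset.range k, digitBlock a b x j * 2 ^ (a k - a (j + 1)) : ℤ) : ℝ) /
      2 ^ a k = ∑ j ∈ Finset.range k, (digitBlock a b x j : ℝ) / 2 ^ a (j + 1) := by
    push_cast
    rw [Finset.sum_div]
    refine Finset.sum_congr rfl fun j hj => ?_
    have hle : a (j + 1) ≤ a k := ha (Finset.mem_range.1 hj)
    obtain ⟨e, he⟩ := Nat.exists_eq_add_of_le hle
    rw [he, Nat.add_sub_cancel_left, pow_add]
    field_simp
  rw [hint, spread, ← hsplit, add_sub_cancel_left]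
  exact htail

theorem freeCount_strictMono (hab : ∀ k, b k < a (k + 1)) : StrictMono (freeCount a b) :=
  strictMono_nat_of_lt_succ fun k => by
    have := hab k
    simp only [freeCount]
    omega

theorem abs_sub_le_abs_spread_sub (hb : StrictMono b)
    (hab : ∀ k, b k < a (k + 1)) (hgap : ∀ k, a (k + 1) + 2 ≤ b (k + 1))
    {x y : ℝ} (hx : x ∈ Ico (0 : ℝ) 1) (hy : y ∈ Ico (0 : ℝ) 1) (hxy : x ≠ y) :
    ∃ n : ℕ, ∃ D : ℝ, 1 ≤ D ∧ D ≤ 2 ^ (a (n + 1) - b n) ∧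
      |x - y| ≤ 2 * D / 2 ^ freeCount a b (n + 1) ∧
      D / 2 ^ (a (n + 1) + 1) ≤ |spread a b x - spread a b y| := by
  have hm := freeCount_strictMono hab
  have hex : ∃ k, ⌊2 ^ freeCount a b k * x⌋ ≠ ⌊2 ^ freeCount a b k * y⌋ := by
    by_contra! h
    obtain ⟨k, hk⟩ := exists_pow_lt_of_lt_one (abs_pos.2 (sub_ne_zero.2 hxy))
      (by norm_num : (1 / 2 : ℝ) < 1)
    have h1 := Int.abs_sub_lt_one_of_floor_eq_floor (h k)
    rw [← mul_sub, abs_mul, abs_of_pos (by positivity)] at h1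
    have h2 : (2 : ℝ) ^ k ≤ 2 ^ freeCount a b k :=
      pow_le_pow_right₀ (by norm_num) (hm.id_le k)
    have h3 : (2 : ℝ) ^ k * |x - y| < 1 :=
      (mul_le_mul_of_nonneg_right h2 (abs_nonneg _)).trans_lt h1
    rw [one_div_pow, div_lt_iff₀ (by positivity)] at hk
    linarith
  classical
  obtain ⟨k, hk, hmin⟩ : ∃ k, ⌊2 ^ freeCount a b k * x⌋ ≠ ⌊2 ^ freeCount a b k * y⌋ ∧
      ∀ j < k, ⌊2 ^ freeCount a b j * x⌋ = ⌊2 ^ freeCount a b j * y⌋ :=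
    ⟨Nat.find hex, Nat.find_spec hex, fun j hj => not_not.1 (Nat.find_min hex hj)⟩
  obtain _ | n := k
  · refine absurd ?_ hk
    simp only [freeCount, pow_zero, one_mul]
    rw [Int.floor_eq_zero_iff.2 hx, Int.floor_eq_zero_iff.2 hy]
  have hDeq : digitBlock a b x n - digitBlock a b y n =
      ⌊2 ^ freeCount a b (n + 1) * x⌋ - ⌊2 ^ freeCount a b (n + 1) * y⌋ := by
    simp only [digitBlock, hmin n n.lt_succ_self]
    ring
  have hDR : (digitBlock a b x n : ℝ) - digitBlock a b y n =
      ⌊2 ^ freeCount a b (n + 1) * x⌋ - ⌊2 ^ freeCount a b (n + 1) * y⌋ := by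
    exact_mod_cast hDeq
  have hD1 : (1 : ℝ) ≤ |(digitBlock a b x n : ℝ) - digitBlock a b y n| := by
    have : 1 ≤ |digitBlock a b x n - digitBlock a b y n| := by
      rw [hDeq]; exact Int.one_le_abs (sub_ne_zero.2 hk)
    exact_mod_cast this
  refine ⟨n, |(digitBlock a b x n : ℝ) - digitBlock a b y n|, hD1, ?_, ?_, ?_⟩
  · have h := abs_digitBlock_sub_div_le hab x y n
    rwa [abs_div, abs_of_pos (by positivity : (0 : ℝ) < 2 ^ a (n + 1)),
      ← two_pow_sub_div_two_pow (hab n), div_le_div_iff_of_pos_right (by positivity)] at h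
  · rw [le_div_iff₀ (by positivity)]
    have h1 := Int.floor_le (2 ^ freeCount a b (n + 1) * x)
    have h2 := Int.lt_floor_add_one (2 ^ freeCount a b (n + 1) * x)
    have h3 := Int.floor_le (2 ^ freeCount a b (n + 1) * y)
    have h4 := Int.lt_floor_add_one (2 ^ freeCount a b (n + 1) * y)
    rw [hDR] at hD1 ⊢
    have h5 : |x - y| * 2 ^ freeCount a b (n + 1) =
        |2 ^ freeCount a b (n + 1) * x - 2 ^ freeCount a b (n + 1) * y| := by
      rw [← mul_sub, abs_mul, abs_of_pos (by positivity : (0 : ℝ) < 2 ^ freeCount a b (n + 1)),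
        mul_comm]
    rw [h5, abs_le]
    have h6 := neg_abs_le ((⌊2 ^ freeCount a b (n + 1) * x⌋ : ℝ) -
      ⌊2 ^ freeCount a b (n + 1) * y⌋)
    have h7 := le_abs_self ((⌊2 ^ freeCount a b (n + 1) * x⌋ : ℝ) -
      ⌊2 ^ freeCount a b (n + 1) * y⌋)
    constructor <;> linarith
  · set t : ℕ → ℝ := fun j =>
      ((digitBlock a b x j : ℝ) - digitBlock a b y j) / 2 ^ a (j + 1) with ht
    have htb : ∀ j, |t j| ≤ (1 / 2) ^ b j := abs_digitBlock_sub_div_le hab x y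
    have hdiff : spread a b x - spread a b y = ∑' j, t j := by
      rw [spread, spread, ← (summable_of_abs_le_half_pow hb
        (abs_digitBlock_div_le hab x)).tsum_sub (summable_of_abs_le_half_pow hb
        (abs_digitBlock_div_le hab y))]
      simp only [ht, sub_div]
    have hzero : ∑ j ∈ Finset.range n, t j = 0 := by
      refine Finset.sum_eq_zero fun j hj => ?_
      have hj := Finset.mem_range.1 hj
      simp [ht, digitBlock, hmin j (by omega), hmin (j + 1) (by omega)]
    have hsplit := (summable_of_abs_le_half_pow hb htb).sum_add_tsum_nat_add (n + 1)
    rw [Finset.sum_range_succ, hzero, zero_add] at hsplit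
    have htail := abs_tsum_add_le_two_mul_half_pow hb htb (n + 1)
    have hsmall : 2 * (1 / 2 : ℝ) ^ b (n + 1) ≤ 1 / 2 ^ (a (n + 1) + 1) := by
      calc 2 * (1 / 2 : ℝ) ^ b (n + 1) ≤ 2 * (1 / 2) ^ (a (n + 1) + 2) := by
            gcongr 2 * ?_
            exact pow_le_pow_of_le_one (by norm_num) (by norm_num) (hgap n)
        _ = 1 / 2 ^ (a (n + 1) + 1) := by
            rw [one_div_pow, pow_succ _ (a (n + 1) + 1)]
            field_simp
    have habs : |t n| = |(digitBlock a b x n : ℝ) - digitBlock a b y n| / 2 ^ a (n + 1) := by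
      rw [ht, abs_div, abs_of_pos (by positivity : (0 : ℝ) < 2 ^ a (n + 1))]
    have htri : |t n| - |∑' j, t (j + (n + 1))| ≤ |∑' j, t j| := by
      rw [← hsplit]
      have := abs_sub_abs_le_abs_sub (t n) (-∑' j, t (j + (n + 1)))
      rwa [abs_neg, sub_neg_eq_add] at this
    have hhalf : 1 / 2 ^ (a (n + 1) + 1) ≤
        |(digitBlock a b x n : ℝ) - digitBlock a b y n| / 2 ^ (a (n + 1) + 1) := by
      gcongr
    have hdouble : |(digitBlock a b x n : ℝ) - digitBlock a b y n| / 2 ^ a (n + 1) =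
        2 * (|(digitBlock a b x n : ℝ) - digitBlock a b y n| / 2 ^ (a (n + 1) + 1)) := by
      rw [pow_succ]
      field_simp
    rw [hdiff]
    linarith

theorem abs_sub_le_mul_abs_spread_sub_rpow (hb : StrictMono b)
    (hab : ∀ k, b k < a (k + 1)) (hgap : ∀ k, a (k + 1) + 2 ≤ b (k + 1))
    {r c : ℝ} (hr0 : 0 < r) (hr1 : r ≤ 1) (hc : ∀ k, r * b k - freeCount a b k ≤ c)
    {x y : ℝ} (hx : x ∈ Ico (0 : ℝ) 1) (hy : y ∈ Ico (0 : ℝ) 1) :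
    |x - y| ≤ 2 ^ (c + 2) * |spread a b x - spread a b y| ^ r := by
  rcases eq_or_ne x y with rfl | hxy
  · simp [Real.zero_rpow hr0.ne']
  obtain ⟨n, D, hD1, hDle, hle, hge⟩ := abs_sub_le_abs_spread_sub hb hab hgap hx hy hxy
  have hD0 : 0 < D := by linarith
  have hL : ((a (n + 1) - b n : ℕ) : ℝ) = a (n + 1) - b n := by
    rw [Nat.cast_sub (hab n).le]
  have hDr : D ≤ D ^ r * 2 ^ ((a (n + 1) - b n : ℝ) * (1 - r)) := by
    calc D = D ^ r * D ^ (1 - r) := by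
          rw [← Real.rpow_add hD0]; simp
      _ ≤ D ^ r * (2 ^ (a (n + 1) - b n : ℕ)) ^ (1 - r) := by
          gcongr
      _ = _ := by
          rw [← Real.rpow_natCast, ← Real.rpow_mul (by norm_num), hL]
  have hpow : (2 : ℝ) * (2 ^ ((a (n + 1) - b n : ℝ) * (1 - r)) / 2 ^ freeCount a b (n + 1)) ≤
      2 ^ (c + 2) * ((2 : ℝ) ^ (a (n + 1) + 1))⁻¹ ^ r := by
    have hm : (freeCount a b (n + 1) : ℝ) = freeCount a b n + (a (n + 1) - b n) := by
      rw [freeCount, Nat.cast_add, hL]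
    rw [← Real.rpow_natCast, ← Real.rpow_natCast, ← Real.rpow_neg (by norm_num),
      ← Real.rpow_mul (by norm_num), ← Real.rpow_add (by norm_num),
      ← Real.rpow_sub (by norm_num), hm]
    nth_rewrite 1 [← Real.rpow_one 2]
    rw [← Real.rpow_add (by norm_num)]
    refine Real.rpow_le_rpow_of_exponent_le (by norm_num) ?_
    push_cast
    have := hc n
    linarith
  calc |x - y| ≤ 2 * D / 2 ^ freeCount a b (n + 1) := hle
    _ ≤ 2 * (D ^ r * 2 ^ ((a (n + 1) - b n : ℝ) * (1 - r))) / 2 ^ freeCount a b (n + 1) := by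
        gcongr
    _ = D ^ r * (2 * (2 ^ ((a (n + 1) - b n : ℝ) * (1 - r)) / 2 ^ freeCount a b (n + 1))) := by
        ring
    _ ≤ D ^ r * (2 ^ (c + 2) * ((2 : ℝ) ^ (a (n + 1) + 1))⁻¹ ^ r) := by gcongr
    _ = 2 ^ (c + 2) * (D / 2 ^ (a (n + 1) + 1)) ^ r := by
        rw [div_eq_mul_inv, Real.mul_rpow hD0.le (by positivity)]
        ring
    _ ≤ _ := by gcongr

end spread

/-- The left endpoints of the gaps of binary positions, growing superexponentially. -/
noncomputable def gapStart (β : ℝ) : ℕ → ℕ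
  | 0 => 0
  | k + 1 => (k + 1) * (⌈β * gapStart β k⌉₊ + k + 2)

/-- The right endpoints of the gaps, slightly beyond `β` times the left endpoints. -/
noncomputable def gapEnd (β : ℝ) (k : ℕ) : ℕ := ⌈β * gapStart β k⌉₊ + k + 1

theorem gapStart_succ (β : ℝ) (k : ℕ) :
    gapStart β (k + 1) = (k + 1) * (gapEnd β k + 1) := rfl

theorem gapEnd_lt_gapStart_succ (β : ℝ) (k : ℕ) : gapEnd β k < gapStart β (k + 1) := by
  rw [gapStart_succ]
  nlinarith

theorem mul_gapStart_add_le_gapEnd (β : ℝ) (k : ℕ) :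
    β * gapStart β k + k + 1 ≤ gapEnd β k := by
  have := Nat.le_ceil (β * gapStart β k)
  rw [gapEnd]
  push_cast
  linarith

theorem gapStart_add_le_gapEnd {β : ℝ} (hβ : 1 ≤ β) (k : ℕ) :
    gapStart β k + k + 1 ≤ gapEnd β k := by
  have h1 := mul_gapStart_add_le_gapEnd β k
  have h2 : (gapStart β k : ℝ) ≤ β * gapStart β k :=
    le_mul_of_one_le_left (Nat.cast_nonneg _) hβ
  have h3 : (gapStart β k : ℝ) + k + 1 ≤ gapEnd β k := by linarith
  exact_mod_cast h3

theorem gapStart_monotone {β : ℝ} (hβ : 1 ≤ β) : Monotone (gapStart β) :=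
  monotone_nat_of_le_succ fun k => by
    have h1 := gapStart_add_le_gapEnd hβ k
    have h2 := gapEnd_lt_gapStart_succ β k
    omega

theorem gapEnd_strictMono {β : ℝ} (hβ : 1 ≤ β) : StrictMono (gapEnd β) :=
  strictMono_nat_of_lt_succ fun k => by
    have h1 := gapStart_add_le_gapEnd hβ (k + 1)
    have h2 := gapEnd_lt_gapStart_succ β k
    omega

theorem exists_forall_mul_gapEnd_sub_freeCount_le {β r : ℝ} (hβ : 1 ≤ β) (hr0 : 0 ≤ r)
    (hrβ : r * β < 1) :
    ∃ c : ℝ, ∀ k, r * gapEnd β k - freeCount (gapStart β) (gapEnd β) k ≤ c := by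
  obtain ⟨K, hK⟩ := exists_nat_ge (4 / (1 - r * β))
  have hpos : 0 < 1 - r * β := by linarith
  rw [div_le_iff₀ hpos] at hK
  have hr1 : r ≤ 1 := by nlinarith
  refine ⟨∑ k ∈ Finset.range (K + 1), r * gapEnd β k, fun k => ?_⟩
  have hterm : ∀ k, 0 ≤ r * (gapEnd β k : ℝ) := fun k => by positivity
  rcases lt_or_ge k (K + 1) with hk | hk
  · have h1 := Finset.single_le_sum (f := fun k => r * (gapEnd β k : ℝ))
      (fun k _ => hterm k) (Finset.mem_range.2 hk)
    have h2 : (0 : ℝ) ≤ freeCount (gapStart β) (gapEnd β) k := Nat.cast_nonneg _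
    linarith
  · obtain ⟨n, rfl⟩ : ∃ n, k = n + 1 := ⟨k - 1, by omega⟩
    have h0 : 0 ≤ ∑ k ∈ Finset.range (K + 1), r * (gapEnd β k : ℝ) :=
      Finset.sum_nonneg fun k _ => hterm k
    refine le_trans ?_ h0
    have hKn : (K : ℝ) ≤ n := by exact_mod_cast Nat.succ_le_succ_iff.1 hk
    have hfree : (gapStart β (n + 1) : ℝ) - gapEnd β n ≤
        freeCount (gapStart β) (gapEnd β) (n + 1) := by
      rw [freeCount, Nat.cast_add, Nat.cast_sub (gapEnd_lt_gapStart_succ β n).le]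
      have : (0 : ℝ) ≤ freeCount (gapStart β) (gapEnd β) n := Nat.cast_nonneg _
      linarith
    have hstart : (gapStart β (n + 1) : ℝ) = (n + 1) * (gapEnd β n + 1) := by
      rw [gapStart_succ]
      push_cast
      ring
    have hend : (gapEnd β (n + 1) : ℝ) ≤ β * gapStart β (n + 1) + n + 3 := by
      have := Nat.ceil_lt_add_one (a := β * gapStart β (n + 1)) (by positivity)
      rw [gapEnd]
      push_cast
      linarith
    have hn : (n : ℝ) + 1 ≤ gapEnd β n := by
      have := gapStart_add_le_gapEnd hβ n
      exact_mod_cast (by omega : n + 1 ≤ gapEnd β n)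
    set B : ℝ := (gapEnd β n : ℝ)
    set A : ℝ := (gapStart β (n + 1) : ℝ)
    have hB : 0 < B + 1 := by positivity
    have h4 : 4 * (B + 1) ≤ (1 - r * β) * A := by
      rw [hstart]
      have : 4 ≤ (1 - r * β) * (n + 1) := by nlinarith
      nlinarith
    have h5 : r * (gapEnd β (n + 1) : ℝ) ≤ r * β * A + (n + 3) := by
      have : r * (gapEnd β (n + 1) : ℝ) ≤ r * (β * A + n + 3) := by gcongr
      have h6 : r * ((n : ℝ) + 3) ≤ n + 3 := by nlinarith
      linarith
    linarith

/-- The points whose coordinates are, for some `N` and at every scale `k`, within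
`2 ^ (N - b k)` of an integer multiple of `2 ^ (-(a k + N))`. -/
def dyadicallyApproximable (d : ℕ) (a b : ℕ → ℕ) : Set (EuclideanSpace ℝ (Fin d)) :=
  {v | ∃ N : ℕ, ∀ k i, ∃ p : ℤ, |v i - p / 2 ^ (a k + N)| ≤ 2 ^ N * (1 / 2) ^ b k}

section dyadicallyApproximable

variable {d : ℕ} {a b : ℕ → ℕ}

theorem measurableSet_dyadicallyApproximable :
    MeasurableSet (dyadicallyApproximable d a b) := by
  simp only [dyadicallyApproximable, Set.ofPred_exists, Set.ofPred_forall]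
  refine MeasurableSet.iUnion fun N => MeasurableSet.iInter fun k => MeasurableSet.iInter fun i =>
    MeasurableSet.iUnion fun p => measurableSet_le ?_ measurable_const
  fun_prop

theorem exists_abs_sub_div_two_pow_le_mono {x : ℝ} {m n N M : ℕ} (hNM : N ≤ M)
    (h : ∃ p : ℤ, |x - p / 2 ^ (m + N)| ≤ 2 ^ N * (1 / 2) ^ n) :
    ∃ p : ℤ, |x - p / 2 ^ (m + M)| ≤ 2 ^ M * (1 / 2) ^ n := by
  obtain ⟨p, hp⟩ := h
  obtain ⟨e, rfl⟩ := Nat.exists_eq_add_of_le hNM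
  refine ⟨p * 2 ^ e, ?_⟩
  have : ((p * 2 ^ e : ℤ) : ℝ) / 2 ^ (m + (N + e)) = p / 2 ^ (m + N) := by
    rw [← add_assoc, pow_add 2 (m + N) e]
    push_cast
    field_simp
  rw [this]
  refine hp.trans ?_
  gcongr
  norm_num

theorem midpointConvexSet_dyadicallyApproximable :
    MidpointConvexSet (dyadicallyApproximable d a b) := by
  rintro x ⟨N, hx⟩ y ⟨M, hy⟩
  refine ⟨max N M + 1, fun k i => ?_⟩
  obtain ⟨p, hp⟩ := exists_abs_sub_div_two_pow_le_mono (le_max_left N M) (hx k i)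
  obtain ⟨q, hq⟩ := exists_abs_sub_div_two_pow_le_mono (le_max_right N M) (hy k i)
  refine ⟨p + q, ?_⟩
  have hmid : midpoint ℝ x y i - ((p + q : ℤ) : ℝ) / 2 ^ (a k + (max N M + 1)) =
      ((x i - p / 2 ^ (a k + max N M)) + (y i - q / 2 ^ (a k + max N M))) / 2 := by
    simp only [midpoint_eq_smul_add, PiLp.smul_apply, PiLp.add_apply, smul_eq_mul, invOf_eq_inv]
    rw [← add_assoc, pow_succ]
    push_cast
    field_simp
    ring
  rw [hmid, abs_div, abs_two, div_le_iff₀ two_pos]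
  refine (abs_add_le _ _).trans ?_
  have h2 : (0 : ℝ) ≤ 2 ^ max N M * (1 / 2) ^ b k := by positivity
  rw [pow_succ]
  linarith

theorem toLp_spread_mem_dyadicallyApproximable (ha : Monotone a) (hb : StrictMono b)
    (hab : ∀ k, b k < a (k + 1)) (x : Fin d → ℝ) :
    WithLp.toLp 2 (fun i => spread a b (x i)) ∈ dyadicallyApproximable d a b := by
  refine ⟨1, fun k i => ?_⟩
  obtain ⟨p, hp⟩ := exists_abs_spread_sub_le ha hb hab (x i) k
  refine ⟨p * 2, ?_⟩
  have : ((p * 2 : ℤ) : ℝ) / 2 ^ (a k + 1) = p / 2 ^ a k := by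
    rw [pow_succ]
    push_cast
    field_simp
  rw [this, pow_one]
  exact hp

theorem dist_le_of_forall_abs_sub_le {x y : EuclideanSpace ℝ (Fin d)} {ε : ℝ} (hε : 0 ≤ ε)
    (h : ∀ i, |x i - y i| ≤ ε) : dist x y ≤ (d + 1) * ε := by
  rw [EuclideanSpace.dist_eq]
  refine Real.sqrt_le_iff.2 ⟨by positivity, ?_⟩
  calc ∑ i, dist (x i) (y i) ^ 2 ≤ ∑ _i : Fin d, ε ^ 2 := by
        refine Finset.sum_le_sum fun i _ => ?_
        rw [Real.dist_eq]
        exact pow_le_pow_left₀ (abs_nonneg _) (h i) 2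
    _ = d * ε ^ 2 := by simp
    _ ≤ ((d + 1) * ε) ^ 2 := by
        rw [mul_pow]
        gcongr
        nlinarith [(Nat.cast_nonneg d : (0 : ℝ) ≤ d)]

theorem hausdorffMeasure_dyadicallyApproximable_eq_zero {s : ℝ} (hs : 0 < s)
    (hb : StrictMono b) (hab : ∀ k, d * a k + s * k ≤ s * b k) :
    μH[s] (dyadicallyApproximable d a b) = 0 := by
  have hcover : dyadicallyApproximable d a b ⊆ ⋃ (N : ℕ) (R : ℕ),
      {v | (∀ k i, ∃ p : ℤ, |v i - p / 2 ^ (a k + N)| ≤ 2 ^ N * (1 / 2) ^ b k) ∧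
        ∀ i, |v i| ≤ R} := by
    rintro v ⟨N, hv⟩
    obtain ⟨R, hR⟩ := exists_nat_ge ‖v‖
    simp only [mem_iUnion]
    exact ⟨N, R, hv, fun i => (PiLp.norm_apply_le v i).trans hR⟩
  refine measure_mono_null hcover (measure_iUnion_null fun N => measure_iUnion_null fun R => ?_)
  set M : ℕ → ℕ := fun k => (R + 2 ^ N) * 2 ^ (a k + N) with hM
  set C : ℝ := (d + 1) * (2 * 2 ^ N) with hC
  set K : ℝ := (3 * ((R + 2 ^ N) * 2 ^ N)) ^ d * C ^ s with hK
  have hC0 : 0 ≤ C := by positivity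
  have hhalf : Tendsto (fun k => (1 / 2 : ℝ) ^ b k) atTop (nhds 0) :=
    (tendsto_pow_atTop_nhds_zero_of_lt_one (by norm_num) (by norm_num)).comp hb.tendsto_atTop
  have hbound : ∀ k, ((3 * M k : ℝ) ^ d) * (C * (1 / 2) ^ b k) ^ s ≤ K * ((2 : ℝ) ^ (-s)) ^ k := by
    intro k
    have h1 : ((3 * M k : ℝ) ^ d) * (C * (1 / 2) ^ b k) ^ s =
        K * ((2 : ℝ) ^ (d * a k : ℝ) * 2 ^ (-(s * b k))) := by
      have e1 : (3 * M k : ℝ) ^ d = (3 * ((R + 2 ^ N) * 2 ^ N)) ^ d * 2 ^ (d * a k : ℝ) := by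
        rw [mul_comm (d : ℝ), Real.rpow_mul_natCast (by norm_num), Real.rpow_natCast, ← mul_pow, hM]
        push_cast
        rw [pow_add]
        ring
      have e2 : ((1 / 2 : ℝ) ^ b k) ^ s = 2 ^ (-(s * b k)) := by
        rw [← Real.rpow_natCast, one_div, Real.inv_rpow (by norm_num),
          ← Real.rpow_neg (by norm_num), ← Real.rpow_mul (by norm_num)]
        ring_nf
      rw [Real.mul_rpow hC0 (by positivity), e1, e2, hK]
      ring
    have h2 : ((2 : ℝ) ^ (-s)) ^ k = 2 ^ (-s * k) := by
      rw [Real.rpow_mul_natCast (by norm_num)]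
    rw [h1, h2, ← Real.rpow_add (by norm_num)]
    gcongr
    · norm_num
    · linarith [hab k]
  have hlim : Tendsto (fun k => ENNReal.ofReal (K * ((2 : ℝ) ^ (-s)) ^ k)) atTop (nhds 0) := by
    have h := (tendsto_pow_atTop_nhds_zero_of_lt_one (r := (2 : ℝ) ^ (-s)) (by positivity)
      (Real.rpow_lt_one_of_one_lt_of_neg (by norm_num) (by linarith))).const_mul K
    simpa using ENNReal.tendsto_ofReal h
  have hr : Tendsto (fun k => ENNReal.ofReal (C * (1 / 2) ^ b k)) atTop (nhds 0) := by
    simpa using ENNReal.tendsto_ofReal (hhalf.const_mul C)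
  let t : ∀ k : ℕ, (Fin d → Finset.Icc (-(M k : ℤ)) (M k)) → Set (EuclideanSpace ℝ (Fin d)) :=
    fun k p => {v | ∀ i, |v i - (p i : ℤ) / 2 ^ (a k + N)| ≤ 2 ^ N * (1 / 2) ^ b k}
  have hdiam : ∀ k p, ediam (t k p) ≤ ENNReal.ofReal (C * (1 / 2) ^ b k) := by
    intro k p
    refine ediam_le fun v hv w hw => ?_
    rw [edist_dist]
    refine ENNReal.ofReal_le_ofReal ?_
    rw [hC, mul_assoc]
    refine dist_le_of_forall_abs_sub_le (by positivity) fun i => ?_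
    have h1 := hv i
    have h2 := hw i
    rw [abs_le] at h1 h2 ⊢
    constructor <;> linarith
  refine le_antisymm ?_ bot_le
  refine (Measure.hausdorffMeasure_le_liminf_sum s _ _ hr t
    (Eventually.of_forall hdiam) (Eventually.of_forall fun k v hv => ?_)).trans ?_
  · choose p hp using hv.1 k
    have hpM : ∀ i, p i ∈ Finset.Icc (-(M k : ℤ)) (M k) := fun i => by
      rw [Finset.mem_Icc, ← abs_le]
      have h1 : |(p i : ℝ) / 2 ^ (a k + N)| ≤ R + 2 ^ N := by
        have h2 := hp i
        have h3 := hv.2 i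
        have h4 : (2 : ℝ) ^ N * (1 / 2) ^ b k ≤ 2 ^ N :=
          mul_le_of_le_one_right (by positivity) (pow_le_one₀ (by norm_num) (by norm_num))
        rw [abs_le] at h2 h3 ⊢
        constructor <;> linarith
      rw [abs_div, abs_of_pos (by positivity : (0 : ℝ) < 2 ^ (a k + N)),
        div_le_iff₀ (by positivity)] at h1
      rw [hM]
      exact_mod_cast h1
    exact mem_iUnion.2 ⟨fun i => ⟨p i, hpM i⟩, hp⟩
  · rw [← hlim.liminf_eq]
    refine liminf_le_liminf (Eventually.of_forall fun k => ?_)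
    calc ∑ p, ediam (t k p) ^ s
        ≤ ∑ _p : Fin d → Finset.Icc (-(M k : ℤ)) (M k),
            ENNReal.ofReal (C * (1 / 2) ^ b k) ^ s :=
          Finset.sum_le_sum fun p _ => ENNReal.rpow_le_rpow (hdiam k p) hs.le
      _ = ENNReal.ofReal (((2 * M k + 1 : ℕ) : ℝ) ^ d * (C * (1 / 2) ^ b k) ^ s) := by
          have hcard : ((M k : ℤ) + 1 - -(M k : ℤ)).toNat = 2 * M k + 1 := by omega
          rw [Finset.sum_const, Finset.card_univ, Fintype.card_fun, Fintype.card_coe, Int.card_Icc,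
            Fintype.card_fin, hcard,
            ENNReal.ofReal_mul (p := ((2 * M k + 1 : ℕ) : ℝ) ^ d) (by positivity),
            ← ENNReal.ofReal_rpow_of_nonneg (by positivity) hs.le, nsmul_eq_mul,
            ENNReal.ofReal_pow (by positivity), ENNReal.ofReal_natCast, Nat.cast_pow]
      _ ≤ ENNReal.ofReal (K * ((2 : ℝ) ^ (-s)) ^ k) := by
          refine ENNReal.ofReal_le_ofReal (le_trans ?_ (hbound k))
          gcongr
          have h1 : 1 ≤ M k := Nat.one_le_iff_ne_zero.2 (by positivity)
          exact_mod_cast (by omega : 2 * M k + 1 ≤ 3 * M k)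

theorem mul_natCast_le_dimH_dyadicallyApproximable (ha : Monotone a) (hb : StrictMono b)
    (hab : ∀ k, b k < a (k + 1)) (hgap : ∀ k, a (k + 1) + 2 ≤ b (k + 1))
    {r : NNReal} {c : ℝ} (hr0 : 0 < r) (hr1 : r ≤ 1)
    (hc : ∀ k, r * b k - freeCount a b k ≤ c) :
    (d : ℝ≥0∞) * r ≤ dimH (dyadicallyApproximable d a b) := by
  have hholder : ∀ x ∈ Ico (0 : ℝ) 1, ∀ y ∈ Ico (0 : ℝ) 1,
      |x - y| ≤ 2 ^ (c + 2) * |spread a b x - spread a b y| ^ (r : ℝ) := fun x hx y hy =>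
    abs_sub_le_mul_abs_spread_sub_rpow hb hab hgap (by exact_mod_cast hr0)
      (by exact_mod_cast hr1) hc hx hy
  have hinj : InjOn (spread a b) (Ico 0 1) := fun x hx y hy hxy => by
    have := hholder x hx y hy
    rw [hxy, sub_self, abs_zero, Real.zero_rpow (by exact_mod_cast hr0.ne'), mul_zero] at this
    exact sub_eq_zero.1 (abs_nonpos_iff.1 this)
  set Q : Set (Fin d → ℝ) := {x | ∀ i, x i ∈ Ico (0 : ℝ) 1}
  set G : (Fin d → ℝ) → EuclideanSpace ℝ (Fin d) :=
    fun x => WithLp.toLp 2 (fun i => spread a b (x i))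
  set F : EuclideanSpace ℝ (Fin d) → Fin d → ℝ :=
    fun v i => Function.invFunOn (spread a b) (Ico 0 1) (v i)
  have hFG : ∀ x ∈ Q, F (G x) = x := fun x hx =>
    funext fun i => hinj.leftInvOn_invFunOn (hx i)
  have hF : HolderOnWith ((2 : NNReal) ^ (c + 2)) r F (G '' Q) := by
    rintro _ ⟨x, hx, rfl⟩ _ ⟨y, hy, rfl⟩
    rw [hFG x hx, hFG y hy, edist_pi_le_iff]
    intro i
    rw [edist_dist, edist_dist, ENNReal.ofReal_rpow_of_nonneg dist_nonneg r.coe_nonneg,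
      ← ENNReal.ofReal_coe_nnreal, ← ENNReal.ofReal_mul (by positivity), Real.dist_eq]
    refine ENNReal.ofReal_le_ofReal ((hholder _ (hx i) _ (hy i)).trans ?_)
    push_cast
    have := PiLp.norm_apply_le (G x - G y) i
    rw [← dist_eq_norm] at this
    gcongr
    exact this
  have himage : F '' (G '' Q) = Q := by
    rw [← image_comp]
    exact (image_congr fun x hx => hFG x hx).trans (image_id Q)
  have hball : ball (fun _ : Fin d => (1 / 2 : ℝ)) (1 / 2) ⊆ Q := fun x hx i => by
    have h := (dist_pi_lt_iff (by norm_num)).1 (mem_ball.1 hx) i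
    rw [Real.dist_eq, abs_lt] at h
    constructor <;> linarith
  have hQ : (d : ℝ≥0∞) ≤ dimH Q := by
    rw [← Real.dimH_ball_pi_fin (fun _ : Fin d => (1 / 2 : ℝ)) (by norm_num : (0 : ℝ) < 1 / 2)]
    exact dimH_mono hball
  have hdim := hF.dimH_image_le hr0
  rw [himage] at hdim
  refine ENNReal.mul_le_of_le_div ((hQ.trans hdim).trans ?_)
  gcongr
  rintro _ ⟨x, -, rfl⟩
  exact toLp_spread_mem_dyadicallyApproximable ha hb hab x

end dyadicallyApproximable

theorem not_essentiallyConvex_of_hausdorffMeasure_dimH_eq_zero {d : ℕ}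
    {E : Set (EuclideanSpace ℝ (Fin d))} {s : ℝ} (hs : 0 ≤ s)
    (hdim : dimH E = ENNReal.ofReal s) (hE : μH[s] E = 0) : ¬ EssentiallyConvex E := by
  rintro ⟨n, -, -, L, hn, hEL, ⟨p, hp⟩, -⟩
  set f : L.direction → EuclideanSpace ℝ (Fin d) :=
    fun w => (w : EuclideanSpace ℝ (Fin d)) + p with hf
  have hiso : Isometry f := fun v w => by simp [hf, edist_add_right, Subtype.edist_eq]
  set g : L.direction → L := fun w =>
    ⟨(w : EuclideanSpace ℝ (Fin d)) + p, AffineSubspace.vadd_mem_of_mem_direction w.2 p.2⟩ with hg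
  have hgc : Continuous g := by fun_prop
  have hint : (interior (f ⁻¹' E)).Nonempty := by
    refine ⟨0, interior_maximal (s := f ⁻¹' E) (t := g ⁻¹' (interior (Subtype.val ⁻¹' E)))
      (fun w hw => interior_subset (s := (Subtype.val : L → _) ⁻¹' E) hw)
      (isOpen_interior.preimage hgc) ?_⟩
    have : g 0 = p := Subtype.ext (by simp [hg])
    simpa [this] using hp
  have hrange : E ⊆ range f := fun x hx =>
    ⟨⟨x - p, AffineSubspace.vsub_mem_direction (hEL hx) p.2⟩, by simp [hf]⟩
  have himage : f '' (f ⁻¹' E) = E := image_preimage_eq_of_subset hrange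
  have hfin : dimH (f ⁻¹' E) = (n : ℝ≥0∞) := by
    rw [Real.dimH_of_nonempty_interior hint, hn]
  rw [← hiso.dimH_image, himage, hdim, ← ENNReal.ofReal_natCast,
    ENNReal.ofReal_eq_ofReal_iff hs (Nat.cast_nonneg n)] at hfin
  rw [← himage, hiso.hausdorffMeasure_image (Or.inl hs), hfin, ← hn] at hE
  exact (Measure.measure_pos_of_nonempty_interior _ hint).ne' hE

theorem exists_midpointConvex_not_essentiallyConvex_hausdorffMeasure_zero
    (d : ℕ) (s : ℝ) (hs : 0 < s) (hsd : s < d) :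
    ∃ E₁ : Set (EuclideanSpace ℝ (Fin d)), MeasurableSet E₁ ∧
      dimH E₁ = ENNReal.ofReal s ∧ MidpointConvexSet E₁ ∧
      ¬ EssentiallyConvex E₁ ∧ μH[s] E₁ = 0 := by
  set β : ℝ := d / s with hβdef
  have hd : (0 : ℝ) < d := hs.trans hsd
  have hβ : 1 ≤ β := (one_le_div hs).2 hsd.le
  have hsβ : s * β = d := mul_div_cancel₀ _ hs.ne'
  have hnull : μH[s] (dyadicallyApproximable d (gapStart β) (gapEnd β)) = 0 := by
    refine hausdorffMeasure_dyadicallyApproximable_eq_zero hs (gapEnd_strictMono hβ) fun k => ?_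
    have := mul_le_mul_of_nonneg_left (mul_gapStart_add_le_gapEnd β k) hs.le
    rw [mul_add, mul_add, ← mul_assoc, hsβ] at this
    linarith
  have hdim : dimH (dyadicallyApproximable d (gapStart β) (gapEnd β)) = ENNReal.ofReal s := by
    apply le_antisymm
    · refine dimH_le_of_hausdorffMeasure_ne_top ?_
      rw [Real.coe_toNNReal s hs.le, hnull]
      exact ENNReal.zero_ne_top
    · refine le_of_forall_lt fun c hc => ?_
      obtain ⟨q, hcq, hqs⟩ := ENNReal.lt_iff_exists_nnreal_btwn.1 hc
      refine hcq.trans_le ?_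
      have hq0 : 0 < q := by exact_mod_cast pos_of_gt hcq
      have hqs' : (q : ℝ) < s := by
        rwa [← ENNReal.ofReal_coe_nnreal, ENNReal.ofReal_lt_ofReal_iff hs] at hqs
      have hdN : (0 : NNReal) < d := by exact_mod_cast hd
      have hr : ((q / d : NNReal) : ℝ) * β < 1 := by
        rw [hβdef]
        push_cast
        field_simp
        exact hqs'
      obtain ⟨c, hc⟩ := exists_forall_mul_gapEnd_sub_freeCount_le hβ (q / d).coe_nonneg hr
      have hr1 : q / d ≤ 1 := by
        rw [← NNReal.coe_le_coe]
        have := (q / d).coe_nonneg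
        push_cast at *
        nlinarith
      have hle := mul_natCast_le_dimH_dyadicallyApproximable (d := d) (gapStart_monotone hβ)
        (gapEnd_strictMono hβ) (gapEnd_lt_gapStart_succ β)
        (fun k => by have := gapStart_add_le_gapEnd hβ (k + 1); omega)
        (div_pos hq0 hdN) hr1 hc
      refine le_trans (le_of_eq ?_) hle
      rw [← ENNReal.coe_natCast, ← ENNReal.coe_mul, mul_div_cancel₀ _ hdN.ne']
  exact ⟨_, measurableSet_dyadicallyApproximable, hdim, midpointConvexSet_dyadicallyApproximable,
    not_essentiallyConvex_of_hausdorffMeasure_dimH_eq_zero hs.le hdim hnull, hnull⟩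
end

section
/- Let s > 0, let E ⊆ ℝ^d be a mid-point convex Borel set with 0 ∈ E and y ∈ E, and suppose that r₀ > 0 and D > 0 satisfy H^s(E ∩ B̄(y, r₀)) ≥ (D/2)·(2r₀)^s. Then for every integer n ≥ 0 and every odd integer k with 0 < k ≤ 2^n, it holds that H^s(E ∩ B̄(k·2^{−n}·y, 2^{−n}·r₀)) ≥ (D/2)·(2^{1−n}·r₀)^s. -/
open MeasureTheory Set Metric Filter
open scoped ENNReal

/-- Contracting by `1 / 2` towards a point `p` of a midpoint convex set `E` maps `E` into itself,
hence bounds from below the Hausdorff measure of `E` in balls of half the radius. -/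
theorem MidpointConvexSet.hausdorffMeasure_inter_closedBall_midpoint {d : ℕ}
    {E : Set (EuclideanSpace ℝ (Fin d))} (hE : MidpointConvexSet E)
    {p : EuclideanSpace ℝ (Fin d)} (hp : p ∈ E) (x : EuclideanSpace ℝ (Fin d)) (r : ℝ)
    {s : ℝ} (hs : 0 ≤ s) :
    ENNReal.ofReal ((1 / 2) ^ s) * μH[s] (E ∩ closedBall x r) ≤
      μH[s] (E ∩ closedBall (midpoint ℝ p x) (r / 2)) := by
  have hhalf : ‖(1 / 2 : ℝ)‖₊ = 1 / 2 := by
    ext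
    simp
  have himage := hausdorffMeasure_homothety_image hs p (one_div_ne_zero (two_ne_zero (α := ℝ)))
    (E ∩ closedBall x r)
  have hcoe : ENNReal.ofReal ((1 / 2 : ℝ) ^ s) = (((1 / 2 : NNReal) ^ s : NNReal) : ℝ≥0∞) := by
    rw [ENNReal.ofReal, Real.toNNReal_rpow_of_nonneg (by norm_num)]
    congr 2
    ext
    simp
  rw [hhalf, ENNReal.smul_def, smul_eq_mul] at himage
  rw [hcoe, ← himage]
  refine measure_mono ?_
  rintro _ ⟨z, ⟨hzE, hz⟩, rfl⟩
  have hmap (w : EuclideanSpace ℝ (Fin d)) :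
      AffineMap.homothety p (1 / 2 : ℝ) w = midpoint ℝ p w := by
    simp [AffineMap.homothety_eq_lineMap, midpoint]
  refine ⟨hmap z ▸ hE p hp z hzE, ?_⟩
  rw [mem_closedBall] at hz ⊢
  rw [hmap]
  have := dist_midpoint_midpoint_le (V := EuclideanSpace ℝ (Fin d)) p z p x
  rw [dist_self, zero_add] at this
  linarith

theorem hausdorffMeasure_dyadic_points_lower_bound
    (d : ℕ) (s : ℝ) (hs : 0 < s)
    (E : Set (EuclideanSpace ℝ (Fin d))) (hE : MeasurableSet E)
    (hmid : MidpointConvexSet E)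
    (h0E : (0 : EuclideanSpace ℝ (Fin d)) ∈ E)
    (y : EuclideanSpace ℝ (Fin d)) (hy : y ∈ E)
    (r₀ D : ℝ) (hr₀ : 0 < r₀) (hD : 0 < D)
    (hbase : ENNReal.ofReal (D / 2 * (2 * r₀) ^ s) ≤ μH[s] (E ∩ closedBall y r₀)) :
    ∀ n : ℕ, ∀ k : ℕ, Odd k → 0 < k → k ≤ 2 ^ n →
      ENNReal.ofReal (D / 2 * ((2 : ℝ) ^ (1 - (n : ℤ)) * r₀) ^ s) ≤
        μH[s] (E ∩ closedBall (((k : ℝ) / 2 ^ n) • y) (r₀ / 2 ^ n)) := by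
  intro n
  induction n with
  | zero =>
    intro k _ hpos hk
    obtain rfl : k = 1 := by simp at hk; omega
    simpa using hbase
  | succ n ih =>
    have hscale : ENNReal.ofReal (D / 2 * ((2 : ℝ) ^ (1 - ((n + 1 : ℕ) : ℤ)) * r₀) ^ s) =
        ENNReal.ofReal ((1 / 2) ^ s) *
          ENNReal.ofReal (D / 2 * ((2 : ℝ) ^ (1 - (n : ℤ)) * r₀) ^ s) := by
      have hpow : (2 : ℝ) ^ (1 - ((n + 1 : ℕ) : ℤ)) = 1 / 2 * (2 : ℝ) ^ (1 - (n : ℤ)) := by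
        rw [show 1 - ((n + 1 : ℕ) : ℤ) = -1 + (1 - (n : ℤ)) by push_cast; ring,
          zpow_add₀ two_ne_zero]
        norm_num
      rw [← ENNReal.ofReal_mul (by positivity), hpow, mul_assoc,
        Real.mul_rpow (by norm_num) (by positivity)]
      ring_nf
    have hhalve {p : EuclideanSpace ℝ (Fin d)} (hp : p ∈ E) {j k : ℕ} (hj : Odd j)
        (hjn : j ≤ 2 ^ n)
        (hmidpt : midpoint ℝ p (((j : ℝ) / 2 ^ n) • y) = ((k : ℝ) / 2 ^ (n + 1)) • y) :
        ENNReal.ofReal (D / 2 * ((2 : ℝ) ^ (1 - ((n + 1 : ℕ) : ℤ)) * r₀) ^ s) ≤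
          μH[s] (E ∩ closedBall (((k : ℝ) / 2 ^ (n + 1)) • y) (r₀ / 2 ^ (n + 1))) := by
      have h := hmid.hausdorffMeasure_inter_closedBall_midpoint hp
        (((j : ℝ) / 2 ^ n) • y) (r₀ / 2 ^ n) hs.le
      rw [hmidpt, div_div, ← pow_succ] at h
      rw [hscale]
      exact (mul_le_mul_right (ih j hj hj.pos hjn) _).trans h
    intro k hodd _ hk
    rcases le_or_gt k (2 ^ n) with hle | hgt
    · refine hhalve h0E hodd hle ?_
      rw [midpoint_eq_smul_add, zero_add, smul_smul]
      congr 1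
      rw [pow_succ, invOf_eq_inv]
      field_simp
    · have hn : n ≠ 0 := by
        rintro rfl
        obtain ⟨m, rfl⟩ := hodd
        simp at hgt hk
        omega
      refine hhalve hy (j := k - 2 ^ n) ?_ (by rw [pow_succ] at hk; omega) ?_
      · exact Nat.Odd.sub_even hgt.le hodd (even_two.pow_of_ne_zero hn)
      · rw [midpoint_eq_smul_add, Nat.cast_sub hgt.le, invOf_eq_inv]
        push_cast
        nth_rewrite 1 [← one_smul ℝ y]
        rw [← add_smul, smul_smul]
        congr 1
        rw [pow_succ]
        field_simp
        ring
end
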